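/- arXiv:2512.24631 — 3 statements merged into one kernel-verified Lean document; each statement's English description precedes it below -/
import Mathlib

section
/- Fix ε ∈ (0,1] and κ ∈ (0, 1/6). Then for any positive real number β < 1/3 − 2κ, one has ∑_{ℓ > x^{1/6−κ}} P_ℓ(x) ≪_{ε,κ,β} x^{−β} for all x ≥ 2, where the sum is over integers ℓ > x^{1/6−κ}. -/
open Finset Filter

noncomputable section

/-- `S ℓ p = ∑_{n ≤ ℓ} (n/p)`, the quadratic character sum (Legendre symbol for odd prime `p`). -/
def S (ℓ p : ℕ) : ℤ := ∑ n ∈ Finset.Icc 1 ℓ, jacobiSym (n : ℤ) p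

/-- the first-passage time `f_ε(p) = min {ℓ ≥ 1 : S_ℓ(p) < ε ℓ}`. -/
def fpt (ε : ℝ) (p : ℕ) : ℕ := sInf {ℓ : ℕ | 1 ≤ ℓ ∧ ((S ℓ p : ℝ)) < ε * ℓ}

/-- the odd primes up to a real number `x`. -/
def oddPrimesUpTo (x : ℝ) : Finset ℕ :=
  (Finset.range (⌊x⌋₊ + 1)).filter (fun p => p.Prime ∧ p ≠ 2)

/-- `π_odd(x)`, the number of odd primes up to `x`. -/
def piOdd (x : ℝ) : ℕ := (oddPrimesUpTo x).card

/-- `P_ℓ(x)`, the density of odd primes `p ≤ x` with `S_ℓ(p) ≥ ε ℓ`. -/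
def Pdens (ε : ℝ) (ℓ : ℕ) (x : ℝ) : ℝ :=
  (((oddPrimesUpTo x).filter (fun p => ε * ℓ ≤ (S ℓ p : ℝ))).card : ℝ) / (piOdd x : ℝ)

/-- `a_m(x) = N_m(x)/π_odd(x)`, the proportion of odd primes `p ≤ x` with `f_ε(p) > m`. -/
def aCoef (ε : ℝ) (m : ℕ) (x : ℝ) : ℝ :=
  (((oddPrimesUpTo x).filter (fun p => m < fpt ε p)).card : ℝ) / (piOdd x : ℝ)

/-- `c_u(ℓ)`, the number of triples `(a,b,c) ∈ {1,…,ℓ}³` with `abc = u`. -/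
def cCoef (ℓ u : ℕ) : ℕ :=
  ((Finset.Icc 1 ℓ ×ˢ Finset.Icc 1 ℓ ×ˢ Finset.Icc 1 ℓ).filter
    (fun t => t.1 * t.2.1 * t.2.2 = u)).card

/-- `C_3(ℓ) = ∑_{u,v ≤ ℓ³, uv = □} c_u(ℓ) c_v(ℓ)`. -/
def C3 (ℓ : ℕ) : ℕ :=
  ∑ q ∈ (Finset.Icc 1 (ℓ ^ 3) ×ˢ Finset.Icc 1 (ℓ ^ 3)).filter (fun q => IsSquare (q.1 * q.2)),
    cCoef ℓ q.1 * cCoef ℓ q.2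

theorem divisor_bound (η : ℝ) (hη : 0 < η) :
    ∃ C : ℝ, 1 ≤ C ∧ ∀ u : ℕ, u ≠ 0 → (u.divisors.card : ℝ) ≤ C * (u : ℝ) ^ η := by
  obtain ⟨P, hP⟩ := exists_nat_ge ((2 : ℝ) ^ (1 / η))
  have hl2 : 0 < Real.log 2 := Real.log_pos (by norm_num)
  set K : ℝ := 1 + 1 / (η * Real.log 2) with hK
  have hK1 : 1 ≤ K := by
    have : 0 < 1 / (η * Real.log 2) := by positivity
    linarith
  refine ⟨K ^ P, one_le_pow₀ hK1, fun u hu => ?_⟩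
  have h1 : (u.divisors.card : ℝ) = ∏ p ∈ u.primeFactors, ((u.factorization p : ℝ) + 1) := by
    rw [Nat.card_divisors hu]; push_cast; rfl
  have h2 : (u : ℝ) ^ η = ∏ p ∈ u.primeFactors, ((p : ℝ) ^ (u.factorization p)) ^ η := by
    rw [Real.finsetProd_rpow _ _ (fun i _ => by positivity)]
    congr 1
    conv_lhs => rw [← Nat.prod_factorization_pow_eq_self hu]
    rw [Finsupp.prod]; push_cast; rfl
  have h3 : ∀ p ∈ u.primeFactors, ((u.factorization p : ℝ) + 1) ≤
      (if p < P then K else 1) * ((p : ℝ) ^ (u.factorization p)) ^ η := by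
    intro p hp
    have hp2 : (2 : ℝ) ≤ p := by exact_mod_cast (Nat.prime_of_mem_primeFactors hp).two_le
    set e := u.factorization p
    have hsw : ((p : ℝ) ^ e) ^ η = ((p : ℝ) ^ η) ^ e := by
      rw [← Real.rpow_natCast, ← Real.rpow_natCast, ← Real.rpow_mul (by positivity),
        ← Real.rpow_mul (by positivity), mul_comm]
    split_ifs with h
    · have : 1 + e * (η * Real.log 2) ≤ ((p : ℝ) ^ e) ^ η := by
        calc 1 + e * (η * Real.log 2) ≤ Real.exp (e * (η * Real.log 2)) := by
              linarith [Real.add_one_le_exp (e * (η * Real.log 2))]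
          _ = ((2 : ℝ) ^ e) ^ η := by
              rw [← Real.rpow_natCast, ← Real.rpow_mul (by positivity),
                Real.rpow_def_of_pos (by norm_num)]
              congr 1; ring
          _ ≤ _ := by gcongr
      calc (e : ℝ) + 1 ≤ K * (1 + e * (η * Real.log 2)) := by
            have : K * (1 + e * (η * Real.log 2)) =
              1 + e * (η * Real.log 2) + 1 / (η * Real.log 2) + e := by
              rw [hK]; field_simp; ring
            rw [this]
            have : 0 ≤ e * (η * Real.log 2) + 1 / (η * Real.log 2) := by positivity
            linarith
        _ ≤ _ := by gcongr
    · push Not at h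
      have hp' : (2 : ℝ) ≤ (p : ℝ) ^ η := by
        have : (2 : ℝ) ^ (1 / η) ≤ p := hP.trans (by exact_mod_cast h)
        calc (2 : ℝ) = ((2 : ℝ) ^ (1 / η)) ^ η := by
              rw [← Real.rpow_mul (by norm_num)]; field_simp; simp
          _ ≤ _ := by gcongr
      rw [one_mul, hsw]
      calc (e : ℝ) + 1 ≤ 2 ^ e := by exact_mod_cast Nat.lt_two_pow_self
        _ ≤ _ := by gcongr
  rw [h1, h2]
  refine (Finset.prod_le_prod (fun i _ => by positivity) h3).trans ?_
  rw [Finset.prod_mul_distrib]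
  refine mul_le_mul_of_nonneg_right ?_ (Finset.prod_nonneg fun i _ => by positivity)
  rw [← Finset.prod_filter, Finset.prod_const]
  apply pow_le_pow_right₀ hK1
  calc _ ≤ (Finset.range P).card := by
        apply Finset.card_le_card
        intro p hp; simp at hp ⊢; exact hp.2
    _ = P := by simp

theorem periodic_sum_le (g : ℕ → ℤ) (m : ℕ) (hm : 0 < m) (hb : ∀ n, |g n| ≤ 1)
    (hp : ∀ n, g (m + n) = g n) (h0 : ∑ n ∈ range m, g n = 0) (N : ℕ) :
    |∑ n ∈ range N, g n| ≤ m := by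
  induction N using Nat.strong_induction_on with
  | _ N ih =>
    rcases lt_or_ge N m with h | h
    · calc |∑ n ∈ range N, g n| ≤ ∑ n ∈ range N, |g n| := Finset.abs_sum_le_sum_abs _ _
        _ ≤ ∑ n ∈ range N, 1 := Finset.sum_le_sum fun n _ => hb n
        _ ≤ m := by simp; omega
    · obtain ⟨k, rfl⟩ := Nat.exists_eq_add_of_le h
      rw [Finset.sum_range_add, h0, zero_add]
      simp only [hp]
      exact ih k (by omega)

theorem sum_range_zmod (m : ℕ) [NeZero m] (F : ZMod m → ℤ) :
    ∑ n ∈ range m, F (n : ZMod m) = ∑ z : ZMod m, F z := by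
  refine Finset.sum_bij' (fun n _ => (n : ZMod m)) (fun z _ => z.val) ?_ ?_ ?_ ?_ ?_
  · simp
  · intro z _; simp [ZMod.val_lt]
  · intro n hn; simp at hn; exact ZMod.val_cast_of_lt hn
  · intro z _; simp
  · simp

theorem jac_eq (p : ℕ) [Fact p.Prime] (n : ℕ) :
    jacobiSym (n : ℤ) p = quadraticChar (ZMod p) (n : ZMod p) := by
  rw [← jacobiSym.legendreSym.to_jacobiSym, legendreSym]; simp

theorem jac_abs (a : ℤ) (b : ℕ) : |jacobiSym a b| ≤ 1 := by
  rcases jacobiSym.trichotomy a b with h | h | h <;> simp [h]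

theorem jac_per (p n k : ℕ) : jacobiSym ((p * k + n : ℕ) : ℤ) p = jacobiSym (n : ℤ) p := by
  rw [jacobiSym.mod_left]; simp [Int.add_emod]; rw [← jacobiSym.mod_left]

theorem ringChar_ne (p : ℕ) [Fact p.Prime] (h2 : p ≠ 2) : ringChar (ZMod p) ≠ 2 := by
  rwa [ZMod.ringChar_zmod_n]

theorem icc_eq_range (f : ℕ → ℤ) (h : f 0 = 0) (N : ℕ) :
    ∑ u ∈ Icc 1 N, f u = ∑ u ∈ range (N + 1), f u := by
  apply Finset.sum_subset
  · intro u hu; simp at hu ⊢; omega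
  · intro u hu hu'
    simp at hu hu'
    have : u = 0 := by omega
    rw [this, h]

theorem jac_zero (p : ℕ) (hp : p.Prime) : jacobiSym ((0 : ℕ) : ℤ) p = 0 := by
  exact_mod_cast jacobiSym.zero_left hp.one_lt

theorem corr_le (p q : ℕ) (hp : p.Prime) (hq : q.Prime) (hp2 : p ≠ 2) (hpq : p ≠ q)
    (N : ℕ) :
    |∑ u ∈ Icc 1 N, jacobiSym (u : ℤ) p * jacobiSym (u : ℤ) q| ≤ p * q := by
  have := Fact.mk hp
  have := Fact.mk hq
  have hcop : Nat.Coprime p q := (Nat.coprime_primes hp hq).2 hpq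
  have hpos : 0 < p * q := Nat.mul_pos hp.pos hq.pos
  have : NeZero (p * q) := ⟨hpos.ne'⟩
  have e1 : ∑ u ∈ Icc 1 N, jacobiSym (u : ℤ) p * jacobiSym (u : ℤ) q =
      ∑ u ∈ range (N + 1), jacobiSym (u : ℤ) p * jacobiSym (u : ℤ) q := by
    exact icc_eq_range _ (by rw [jac_zero p hp, zero_mul]) N
  rw [e1]
  have := periodic_sum_le (fun u => jacobiSym (u : ℤ) p * jacobiSym (u : ℤ) q) (p * q) hpos
    ?_ ?_ ?_ (N + 1)
  · exact_mod_cast this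
  · intro n
    rw [abs_mul]
    exact mul_le_one₀ (jac_abs _ _) (abs_nonneg _) (jac_abs _ _)
  · intro n
    rw [jac_per]; congr 1; rw [mul_comm p q, jac_per]
  · have := sum_range_zmod (p * q) (fun z =>
      quadraticChar (ZMod p) (ZMod.chineseRemainder hcop z).1 *
      quadraticChar (ZMod q) (ZMod.chineseRemainder hcop z).2)
    simp only [map_natCast, Prod.fst_natCast, Prod.snd_natCast, ← jac_eq] at this
    rw [this]
    refine (Equiv.sum_comp (ZMod.chineseRemainder hcop).toEquiv
      (fun y => quadraticChar (ZMod p) y.1 * quadraticChar (ZMod q) y.2)).trans ?_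
    rw [Fintype.sum_prod_type]
    simp only [← Finset.mul_sum, ← Finset.sum_mul]
    rw [quadraticChar_sum_zero (ringChar_ne p hp2), zero_mul]

theorem corr_shift (p : ℕ) [Fact p.Prime] (h2 : p ≠ 2) (i j : ZMod p) (hij : i ≠ j) :
    ∑ a : ZMod p, quadraticChar (ZMod p) (a + i) * quadraticChar (ZMod p) (a + j) = -1 := by
  set χ := quadraticChar (ZMod p)
  have hne : χ ≠ 1 := quadraticChar_ne_one (ringChar_ne p h2)
  have hinv : χ⁻¹ = χ := (quadraticChar_isQuadratic (ZMod p)).inv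
  have hJ := jacobiSum_nontrivial_inv hne
  rw [hinv, jacobiSum] at hJ
  set h := j - i with hh
  have h0 : h ≠ 0 := sub_ne_zero.2 hij.symm
  have hh1 : χ h * χ h = 1 := by
    have := quadraticChar_sq_one h0
    rw [← sq]; exact this
  have hn1 : χ (-1) * χ (-1) = 1 := by
    have := quadraticChar_sq_one (F := ZMod p) (a := -1) (by simp)
    rw [← sq]; exact this
  have := Equiv.sum_comp ((Equiv.mulLeft₀ (-h) (neg_ne_zero.2 h0)).trans (Equiv.addRight (-i)))
    (fun a => χ (a + i) * χ (a + j))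
  rw [← this]
  have key : ∀ x : ZMod p, χ (((Equiv.mulLeft₀ (-h) (neg_ne_zero.2 h0)).trans (Equiv.addRight (-i))) x + i)
     * χ (((Equiv.mulLeft₀ (-h) (neg_ne_zero.2 h0)).trans (Equiv.addRight (-i))) x + j) =
     χ (-1) * (χ x * χ (1 - x)) := by
    intro x
    have a1 : ((Equiv.mulLeft₀ (-h) (neg_ne_zero.2 h0)).trans (Equiv.addRight (-i))) x + i = (-1) * h * x := by
      simp
    have a2 : ((Equiv.mulLeft₀ (-h) (neg_ne_zero.2 h0)).trans (Equiv.addRight (-i))) x + j = h * (1 - x) := by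
      simp [hh]; ring
    rw [a1, a2]; simp only [map_mul]
    linear_combination (χ (-1) * χ x * χ (1 - x)) * hh1
  simp only [key, ← Finset.mul_sum, hJ]
  linear_combination -hn1
theorem shift_l2 (p : ℕ) [Fact p.Prime] (h2 : p ≠ 2) (r : ℕ) (hr : r < p) :
    ∑ a : ZMod p, (∑ n ∈ range r, quadraticChar (ZMod p) (a + (n : ZMod p))) ^ 2 ≤ (p : ℤ) * r := by
  simp only [sq, Finset.sum_mul_sum]
  rw [Finset.sum_comm]
  calc _ ≤ ∑ i ∈ range r, (p : ℤ) := ?_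
    _ = _ := by simp [mul_comm]
  apply Finset.sum_le_sum
  intro i hi
  rw [Finset.sum_comm, ← Finset.add_sum_erase _ _ hi]
  have h1 : ∑ a : ZMod p, quadraticChar (ZMod p) (a + (i : ZMod p)) *
      quadraticChar (ZMod p) (a + (i : ZMod p)) ≤ p := by
    calc _ ≤ ∑ a : ZMod p, (1 : ℤ) := by
          apply Finset.sum_le_sum
          intro a _
          rcases eq_or_ne (a + (i : ZMod p)) 0 with h | h
          · rw [h]; simp
          · rw [← sq, quadraticChar_sq_one h]
      _ = p := by simp [ZMod.card]
  have h3 : ∑ j ∈ (range r).erase i, ∑ a : ZMod p, quadraticChar (ZMod p) (a + (i : ZMod p)) *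
      quadraticChar (ZMod p) (a + (j : ZMod p)) ≤ 0 := by
    apply Finset.sum_nonpos
    intro j hj
    rw [corr_shift p h2]
    · norm_num
    · intro hij
      simp at hi hj
      rw [ZMod.natCast_eq_natCast_iff'] at hij
      rw [Nat.mod_eq_of_lt (by omega), Nat.mod_eq_of_lt (by omega)] at hij
      exact hj.1 hij.symm
  linarith

theorem abs_sum_jac_le (s : Finset ℕ) (p : ℕ) : |∑ n ∈ s, jacobiSym (n : ℤ) p| ≤ s.card := by
  calc _ ≤ ∑ n ∈ s, |jacobiSym (n : ℤ) p| := Finset.abs_sum_le_sum_abs _ _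
    _ ≤ ∑ n ∈ s, 1 := Finset.sum_le_sum fun n _ => jac_abs _ _
    _ = _ := by simp

theorem G_mod (p : ℕ) [Fact p.Prime] (h2 : p ≠ 2) (N : ℕ) :
    ∑ n ∈ range N, jacobiSym (n : ℤ) p = ∑ n ∈ range (N % p), jacobiSym (n : ℤ) p := by
  have h0 : ∑ n ∈ range p, jacobiSym (n : ℤ) p = 0 := by
    simp only [jac_eq]
    rw [sum_range_zmod p (fun z => quadraticChar (ZMod p) z),
      quadraticChar_sum_zero (ringChar_ne p h2)]
  induction N using Nat.strong_induction_on with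
  | _ N ih =>
    rcases lt_or_ge N p with h | h
    · rw [Nat.mod_eq_of_lt h]
    · obtain ⟨k, rfl⟩ := Nat.exists_eq_add_of_le h
      have hp := (Fact.out : p.Prime).pos
      rw [Finset.sum_range_add, h0, zero_add, Nat.add_mod_left, ← ih k (by omega)]
      refine Finset.sum_congr rfl fun n _ => ?_
      have := jac_per p n 1
      rwa [mul_one] at this

theorem pointwise (p : ℕ) (hp : p.Prime) (h2 : p ≠ 2) (ε : ℝ) (hε : 0 < ε) (ℓ : ℕ) (hℓ : 1 ≤ ℓ)
    (h : ε * ℓ ≤ (S ℓ p : ℝ)) : ε ^ 3 * (ℓ : ℝ) ^ 2 ≤ 32 * p := by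
  have := Fact.mk hp
  have hℓ' : (1 : ℝ) ≤ ℓ := by exact_mod_cast hℓ
  set r := (ℓ + 1) % p with hr
  have hrp : r < p := Nat.mod_lt _ hp.pos
  have hrl : r ≤ ℓ + 1 := Nat.mod_le _ _
  have hS : S ℓ p = ∑ n ∈ range r, jacobiSym (n : ℤ) p := by
    rw [S, icc_eq_range _ (jac_zero p hp), G_mod p h2]
  set T := S ℓ p with hT
  have hTpos : 0 < T := by
    have : (0 : ℝ) < T := lt_of_lt_of_le (by positivity) h
    exact_mod_cast this
  have hTr : T ≤ r := by
    have := abs_sum_jac_le (range r) p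
    rw [← hS] at this
    simpa using (le_abs_self _).trans this
  set t := (T / 4).toNat with ht
  have htT : 4 * (t : ℤ) ≤ T := by omega
  have htT' : T ≤ 4 * ((t : ℤ) + 1) := by omega
  have htp : t + 1 ≤ p := by omega
  have hW : ∀ a ∈ range (t + 1), T - 2 * t ≤
      ∑ n ∈ range r, quadraticChar (ZMod p) ((a : ZMod p) + (n : ZMod p)) := by
    intro a ha
    have e1 : ∑ n ∈ range r, quadraticChar (ZMod p) ((a : ZMod p) + (n : ZMod p)) =
       ∑ n ∈ range r, jacobiSym ((a + n : ℕ) : ℤ) p := by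
      refine Finset.sum_congr rfl fun n _ => ?_
      rw [jac_eq]; push_cast; rfl
    have e2 := Finset.sum_range_add (fun n : ℕ => jacobiSym (n : ℤ) p) a r
    have e3 := Finset.sum_range_add (fun n : ℕ => jacobiSym (n : ℤ) p) r a
    rw [add_comm r a, ← hS] at e3
    have b1 := abs_sum_jac_le (range a) p
    have b2 : |∑ n ∈ range a, jacobiSym ((r + n : ℕ) : ℤ) p| ≤ a := by
      calc _ ≤ ∑ n ∈ range a, |jacobiSym ((r + n : ℕ) : ℤ) p| := Finset.abs_sum_le_sum_abs _ _
        _ ≤ ∑ n ∈ range a, 1 := Finset.sum_le_sum fun n _ => jac_abs _ _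
        _ = _ := by simp
    rw [e1]
    simp at ha b1
    rw [abs_le] at b1 b2
    have : (a : ℤ) ≤ t := by omega
    linarith
  have hl2 := shift_l2 p h2 r hrp
  rw [← sum_range_zmod p (fun a => (∑ n ∈ range r, quadraticChar (ZMod p) (a + (n : ZMod p))) ^ 2)] at hl2
  have hlow : ((t : ℤ) + 1) * (T - 2 * t) ^ 2 ≤ p * r := by
    calc ((t : ℤ) + 1) * (T - 2 * t) ^ 2 = ∑ a ∈ range (t + 1), (T - 2 * (t : ℤ)) ^ 2 := by simp
      _ ≤ ∑ a ∈ range (t + 1), (∑ n ∈ range r, quadraticChar (ZMod p) ((a : ZMod p) + (n : ZMod p))) ^ 2 := by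
          apply Finset.sum_le_sum
          intro a ha
          have := hW a ha
          have h0 : 0 ≤ T - 2 * t := by omega
          gcongr
      _ ≤ _ := by
          refine (Finset.sum_le_sum_of_subset_of_nonneg ?_ fun _ _ _ => sq_nonneg _).trans hl2
          exact Finset.range_subset_range.2 htp
  have hlowR : ((t : ℝ) + 1) * (T - 2 * t) ^ 2 ≤ p * r := by exact_mod_cast hlow
  have c1 : (4 : ℝ) * t ≤ T := by exact_mod_cast htT
  have c2 : (T : ℝ) ≤ 4 * (t + 1) := by exact_mod_cast htT'
  have hTR : (0 : ℝ) < T := by exact_mod_cast hTpos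
  have hrR : (r : ℝ) ≤ 2 * ℓ := by
    have : (r : ℝ) ≤ ℓ + 1 := by exact_mod_cast hrl
    linarith
  have d1 : (T : ℝ) ^ 3 / 16 ≤ p * r := by
    refine le_trans ?_ hlowR
    calc (T : ℝ) ^ 3 / 16 = (T / 4) * (T / 2) ^ 2 := by ring
      _ ≤ _ := by
        gcongr
        · linarith
        · linarith
  have d2 : (ε * (ℓ : ℝ)) ^ 3 ≤ 32 * (p : ℝ) * (ℓ : ℝ) := by
    calc (ε * (ℓ : ℝ)) ^ 3 ≤ (T : ℝ) ^ 3 := by gcongr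
      _ ≤ 16 * ((p : ℝ) * (r : ℝ)) := by linarith
      _ ≤ 16 * ((p : ℝ) * (2 * (ℓ : ℝ))) := by gcongr
      _ = _ := by ring
  have : (ε ^ 3 * (ℓ : ℝ) ^ 2) * ℓ ≤ (32 * p) * ℓ := by linarith [mul_pow ε (ℓ : ℝ) 3, show (ε ^ 3 * (ℓ : ℝ) ^ 2) * ℓ = ε ^ 3 * (ℓ : ℝ) ^ 3 by ring]
  exact le_of_mul_le_mul_right this (by linarith)

def cK (k ℓ u : ℕ) : ℕ :=
  ((Fintype.piFinset (fun _ : Fin k => Icc 1 ℓ)).filter (fun t => ∏ i, t i = u)).card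

theorem sum_pow_cK (k ℓ : ℕ) (f : ℕ →* ℤ) :
    (∑ n ∈ Icc 1 ℓ, f n) ^ k = ∑ u ∈ Icc 1 (ℓ ^ k), (cK k ℓ u : ℤ) * f u := by
  have h1 : (∑ n ∈ Icc 1 ℓ, f n) ^ k = ∏ _i : Fin k, ∑ n ∈ Icc 1 ℓ, f n := by simp
  rw [h1, Finset.prod_univ_sum]
  have hm : ∀ t ∈ Fintype.piFinset (fun _ : Fin k => Icc 1 ℓ), ∏ i, t i ∈ Icc 1 (ℓ ^ k) := by
    intro t ht
    simp only [Fintype.mem_piFinset, Finset.mem_Icc] at ht ⊢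
    constructor
    · exact Nat.succ_le_of_lt (Finset.prod_pos fun i _ => (ht i).1)
    · calc ∏ i, t i ≤ ∏ _i : Fin k, ℓ := Finset.prod_le_prod' fun i _ => (ht i).2
        _ = _ := by simp
  rw [← Finset.sum_fiberwise_of_maps_to hm]
  refine Finset.sum_congr rfl fun u _ => ?_
  rw [cK, ← nsmul_eq_mul, ← Finset.sum_const]
  refine Finset.sum_congr rfl fun t ht => ?_
  rw [← map_prod, (Finset.mem_filter.1 ht).2]

theorem cK_le (k ℓ u : ℕ) (hu : u ≠ 0) : cK k ℓ u ≤ u.divisors.card ^ k := by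
  have : u.divisors.card ^ k = (Fintype.piFinset (fun _ : Fin k => u.divisors)).card := by simp
  rw [this]
  apply Finset.card_le_card
  intro t ht
  rw [Finset.mem_filter] at ht
  rw [Fintype.mem_piFinset]
  intro i
  rw [Nat.mem_divisors]
  exact ⟨ht.2 ▸ Finset.dvd_prod_of_mem t (Finset.mem_univ i), hu⟩

def jacHom (p : ℕ) : ℕ →* ℤ where
  toFun n := jacobiSym (n : ℤ) p
  map_one' := by simp
  map_mul' a b := by simp [jacobiSym.mul_left]

theorem large_sieve (ε : ℝ) (hε : 0 < ε) (ℓ k X : ℕ) (hℓ : 1 ≤ ℓ) (B : Finset ℕ)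
    (hB : ∀ p ∈ B, p.Prime ∧ p ≠ 2 ∧ p ≤ X) (hS : ∀ p ∈ B, ε * ℓ ≤ (S ℓ p : ℝ))
    (hX : X ^ 3 ≤ ℓ ^ k) (D : ℝ) (hD : ∀ u ∈ Icc 1 (ℓ ^ k), ((u.divisors.card : ℝ)) ^ k ≤ D) :
    (B.card : ℝ) * ε ^ (2 * k) ≤ 2 * D := by
  set N := ℓ ^ k with hN
  set M := B.card with hM
  have hNpos : 0 < N := Nat.pow_pos hℓ
  have hc : ∀ u ∈ Icc 1 N, (cK k ℓ u : ℝ) ≤ D := by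
    intro u hu
    refine le_trans ?_ (hD u hu)
    have hu0 : u ≠ 0 := by simp at hu; omega
    exact_mod_cast cK_le k ℓ u hu0
  have hD0 : 0 ≤ D := le_trans (by positivity) (hD 1 (by simp; omega))
  rcases Nat.eq_zero_or_pos M with h0 | hMpos
  · rw [h0]; simp; exact hD0
  have hMX : M ≤ X := by
    calc M ≤ (Icc 1 X).card := Finset.card_le_card fun p hp => by
            have := hB p hp
            simp; exact ⟨this.1.one_le, this.2.2⟩
      _ = X := by simp
  have hcs : ∑ u ∈ Icc 1 N, (cK k ℓ u : ℝ) = N := by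
    have := sum_pow_cK k ℓ 1
    simp at this
    rw [hN]; exact_mod_cast this.symm
  have hE : ∑ u ∈ Icc 1 N, (cK k ℓ u : ℝ) ^ 2 ≤ D * N := by
    rw [← hcs, Finset.mul_sum]
    refine Finset.sum_le_sum fun u hu => ?_
    rw [sq]; exact mul_le_mul_of_nonneg_right (hc u hu) (by positivity)
  have hlow : (M : ℝ) * (ε * ℓ) ^ k ≤
      ∑ u ∈ Icc 1 N, (cK k ℓ u : ℝ) * ∑ p ∈ B, (jacobiSym (u : ℤ) p : ℝ) := by
    calc (M : ℝ) * (ε * ℓ) ^ k = ∑ p ∈ B, (ε * ℓ) ^ k := by simp [hM]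
      _ ≤ ∑ p ∈ B, (S ℓ p : ℝ) ^ k := by
          refine Finset.sum_le_sum fun p hp => ?_
          have := hS p hp
          gcongr
      _ = ∑ p ∈ B, ∑ u ∈ Icc 1 N, (cK k ℓ u : ℝ) * (jacobiSym (u : ℤ) p : ℝ) := by
          refine Finset.sum_congr rfl fun p hp => ?_
          have := sum_pow_cK k ℓ (jacHom p)
          change (S ℓ p) ^ k = ∑ u ∈ Icc 1 N, (cK k ℓ u : ℤ) * jacobiSym (u : ℤ) p at this
          exact_mod_cast this
      _ = _ := by
          rw [Finset.sum_comm]; simp only [Finset.mul_sum]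
  have hV : ∑ u ∈ Icc 1 N, (∑ p ∈ B, (jacobiSym (u : ℤ) p : ℝ)) ^ 2 ≤ 2 * M * N := by
    have h1 : ∑ u ∈ Icc 1 N, (∑ p ∈ B, (jacobiSym (u : ℤ) p)) ^ 2 ≤ (2 * M * N : ℤ) := by
      simp only [sq, Finset.sum_mul_sum]
      rw [Finset.sum_comm]
      calc _ ≤ ∑ p ∈ B, (2 * N : ℤ) := ?_
        _ = _ := by simp [hM]; ring
      refine Finset.sum_le_sum fun p hp => ?_
      rw [Finset.sum_comm, ← Finset.add_sum_erase _ _ hp]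
      have a1 : ∑ u ∈ Icc 1 N, jacobiSym (u : ℤ) p * jacobiSym (u : ℤ) p ≤ N := by
        calc _ ≤ ∑ u ∈ Icc 1 N, (1 : ℤ) := Finset.sum_le_sum fun u _ => by
              have := jac_abs (u : ℤ) p
              rw [← abs_mul_abs_self]
              exact mul_le_one₀ this (abs_nonneg _) this
          _ = N := by simp
      have a2 : ∑ q ∈ B.erase p, ∑ u ∈ Icc 1 N, jacobiSym (u : ℤ) p * jacobiSym (u : ℤ) q ≤ N := by
        calc _ ≤ ∑ q ∈ B.erase p, ((X : ℤ) * X) := by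
              refine Finset.sum_le_sum fun q hq => ?_
              have hq' := Finset.mem_erase.1 hq
              obtain ⟨hp1, hp2, hp3⟩ := hB p hp
              obtain ⟨hq1, hq2, hq3⟩ := hB q hq'.2
              refine (le_abs_self _).trans ((corr_le p q hp1 hq1 hp2 hq'.1.symm N).trans ?_)
              exact_mod_cast Nat.mul_le_mul hp3 hq3
          _ = ((B.erase p).card * (X * X) : ℕ) := by simp
          _ ≤ ((X ^ 3 : ℕ) : ℤ) := by
              have : (B.erase p).card ≤ X := (Finset.card_le_card (Finset.erase_subset _ _)).trans hMX
              have : (B.erase p).card * (X * X) ≤ X ^ 3 := by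
                calc _ ≤ X * (X * X) := Nat.mul_le_mul_right _ this
                  _ = _ := by ring
              exact_mod_cast this
          _ ≤ N := by exact_mod_cast hX
      linarith
    exact_mod_cast h1
  have hCS := Finset.sum_mul_sq_le_sq_mul_sq (Icc 1 N) (fun u => (cK k ℓ u : ℝ))
    (fun u => ∑ p ∈ B, (jacobiSym (u : ℤ) p : ℝ))
  have hNR : (0 : ℝ) < N := by exact_mod_cast hNpos
  have hMR : (0 : ℝ) < M := by exact_mod_cast hMpos
  have fin : ((M : ℝ) * (ε * ℓ) ^ k) ^ 2 ≤ (D * N) * (2 * M * N) := by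
    calc _ ≤ _ := pow_le_pow_left₀ (by positivity) hlow 2
      _ ≤ _ := hCS
      _ ≤ _ := mul_le_mul hE hV (Finset.sum_nonneg fun _ _ => sq_nonneg _) (by positivity)
  have e : ((M : ℝ) * (ε * ℓ) ^ k) ^ 2 = (M * ε ^ (2 * k)) * (M * N ^ 2) := by
    rw [hN]; push_cast; ring
  rw [e] at fin
  have : (M * ε ^ (2 * k)) * (M * N ^ 2) ≤ (2 * D) * ((M : ℝ) * (N : ℝ) ^ 2) := by linarith
  exact le_of_mul_le_mul_right this (by positivity)
theorem piOdd_eq (x : ℝ) : Nat.primeCounting ⌊x⌋₊ ≤ piOdd x + 1 := by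
  rw [Nat.primeCounting, Nat.primeCounting', Nat.count_eq_card_filter_range]
  have : (range (⌊x⌋₊ + 1)).filter Nat.Prime ⊆ insert 2 (oddPrimesUpTo x) := by
    intro p hp
    simp [oddPrimesUpTo] at hp ⊢
    tauto
  exact (Finset.card_le_card this).trans (Finset.card_insert_le _ _)

theorem piOdd_lower : ∃ c : ℝ, 0 < c ∧ ∀ x : ℝ, 3 ≤ x → c * x ^ ((11 : ℝ) / 12) ≤ piOdd x := by
  have h1 := (isLittleO_log_rpow_atTop (r := 1 / 12) (by norm_num)).bound
    (show (0 : ℝ) < 1 / 4 by norm_num)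
  have h2 := (isLittleO_log_rpow_atTop (r := 1) (by norm_num)).bound
    (show (0 : ℝ) < 1 / 40 by norm_num)
  obtain ⟨X0, hX0⟩ := Filter.eventually_atTop.1 (h1.and (h2.and (Filter.eventually_ge_atTop 10)))
  set X := max X0 10 with hX
  have hX10 : 10 ≤ X := le_max_right _ _
  refine ⟨min 1 (X ^ (-((11 : ℝ) / 12))), by positivity, fun x hx => ?_⟩
  rcases le_total X x with h | h
  · obtain ⟨a1, a2, a3⟩ := hX0 x ((le_max_left _ _).trans h)
    have hlog : 0 < Real.log x := Real.log_pos (by linarith)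
    rw [Real.norm_of_nonneg hlog.le, Real.norm_of_nonneg (by positivity)] at a1 a2
    rw [Real.rpow_one] at a2
    have hp := Chebyshev.pi_ge' (x := x) (by linarith)
    have hl2 := Real.log_two_gt_d9
    have hlx : Real.log (x + 2) ≤ 2 * Real.log x := by
      have : 2 * Real.log x = Real.log (x ^ 2) := by rw [Real.log_pow]; norm_num
      rw [this]
      exact Real.log_le_log (by linarith) (by nlinarith)
    have b1 : x / 2 ≤ (x - 1) * Real.log 2 - Real.log (x + 2) := by nlinarith
    have b2 : 2 * x ^ ((11 : ℝ) / 12) ≤ Nat.primeCounting ⌊x⌋₊ := by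
      refine le_trans ?_ hp
      rw [le_div_iff₀ hlog]
      refine le_trans ?_ b1
      have e : x ^ ((11 : ℝ) / 12) * x ^ ((1 : ℝ) / 12) = x := by
        rw [← Real.rpow_add (by linarith)]; norm_num
      have hpos : 0 < x ^ ((11 : ℝ) / 12) := by positivity
      nlinarith
    have b3 : (Nat.primeCounting ⌊x⌋₊ : ℝ) ≤ piOdd x + 1 := by exact_mod_cast piOdd_eq x
    have b4 : 1 ≤ x ^ ((11 : ℝ) / 12) := Real.one_le_rpow (by linarith) (by norm_num)
    have b5 : min 1 (X ^ (-((11 : ℝ) / 12))) * x ^ ((11 : ℝ) / 12) ≤ 1 * x ^ ((11 : ℝ) / 12) := by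
      gcongr; exact min_le_left _ _
    linarith
  · have : 1 ≤ piOdd x := by
      apply Finset.card_pos.2
      refine ⟨3, ?_⟩
      simp [oddPrimesUpTo]
      have : 3 ≤ ⌊x⌋₊ := Nat.le_floor (by exact_mod_cast hx)
      exact ⟨by omega, Nat.prime_three⟩
    calc min 1 (X ^ (-((11 : ℝ) / 12))) * x ^ ((11 : ℝ) / 12)
        ≤ X ^ (-((11 : ℝ) / 12)) * X ^ ((11 : ℝ) / 12) := by
          gcongr; exact min_le_right _ _
      _ = 1 := by rw [← Real.rpow_add (by linarith)]; norm_num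
      _ ≤ _ := by exact_mod_cast this

/-- For fixed `ε ∈ (0,1]`, `κ ∈ (0,1/6)` and any `0 < β < 1/3 - 2κ`:
`∑_{ℓ > x^(1/6-κ)} P_ℓ(x) ≪_{ε,κ,β} x^(-β)` for all `x ≥ 2`. -/
theorem stmt7 (ε κ β : ℝ) (hε : 0 < ε) (hε1 : ε ≤ 1) (hκ : 0 < κ) (hκ' : κ < 1/6)
    (hβ : 0 < β) (hβ' : β < 1/3 - 2*κ) :
    ∃ C : ℝ, 0 < C ∧ ∀ x : ℝ, 2 ≤ x →
      (∑' ℓ : ℕ, if x ^ ((1 : ℝ)/6 - κ) < (ℓ : ℝ) then Pdens ε ℓ x else 0)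
        ≤ C * x ^ (-β) := by
  set θ := (1 : ℝ) / 6 - κ with hθ
  have hθ0 : 0 < θ := by rw [hθ]; linarith
  obtain ⟨k, hk⟩ := exists_nat_ge (3 / θ)
  have hkR : (0 : ℝ) < k := lt_of_lt_of_le (by positivity) hk
  have hk3 : 3 ≤ θ * k := by rw [div_le_iff₀ hθ0] at hk; linarith
  obtain ⟨Cη, hCη, hdiv⟩ := divisor_bound (1 / (6 * (k : ℝ) ^ 2)) (by positivity)
  obtain ⟨c, hc, hpi⟩ := piOdd_lower
  set A := √(32 / ε ^ 3) with hA
  have hA0 : 0 < A := by positivity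
  set K := 2 * (Cη ^ k * A ^ ((1 : ℝ) / 6)) / ε ^ (2 * k) with hK
  have hK0 : 0 < K := by positivity
  refine ⟨A * (K / c), by positivity, fun x hx => ?_⟩
  have hx0 : 0 < x := by linarith
  have hlarge : ∀ ℓ : ℕ, x ^ θ < (ℓ : ℝ) → Pdens ε ℓ x ≠ 0 →
      1 ≤ ℓ ∧ (ℓ : ℝ) ≤ A * √x ∧ Pdens ε ℓ x ≤ K / c * x ^ (-((5 : ℝ) / 6)) := by
    intro ℓ hℓ hP
    have hℓ0 : (0 : ℝ) < ℓ := lt_trans (by positivity) hℓ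
    have hℓ1 : 1 ≤ ℓ := by exact_mod_cast hℓ0
    set B := (oddPrimesUpTo x).filter (fun p => ε * ℓ ≤ (S ℓ p : ℝ)) with hB
    have hBp : ∀ p ∈ B, (p.Prime ∧ p ≠ 2 ∧ p ≤ ⌊x⌋₊) ∧ ε * ℓ ≤ (S ℓ p : ℝ) := by
      intro p hp
      simp only [hB, oddPrimesUpTo, Finset.mem_filter, Finset.mem_range] at hp
      exact ⟨⟨hp.1.2.1, hp.1.2.2, by omega⟩, hp.2⟩
    have hBne : B.Nonempty := by
      by_contra h
      rw [Finset.not_nonempty_iff_eq_empty] at h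
      apply hP
      rw [Pdens, ← hB, h]; simp
    obtain ⟨p, hp⟩ := hBne
    obtain ⟨⟨p1, p2, p3⟩, p4⟩ := hBp p hp
    have hpx : (p : ℝ) ≤ x := (by exact_mod_cast p3 : (p : ℝ) ≤ ⌊x⌋₊).trans (Nat.floor_le hx0.le)
    have hx3 : 3 ≤ x := by
      have : 3 ≤ p := by have := p1.two_le; omega
      have : (3 : ℝ) ≤ p := by exact_mod_cast this
      linarith
    have hℓA : (ℓ : ℝ) ≤ A * √x := by
      have := pointwise p p1 p2 ε hε ℓ hℓ1 p4
      rw [hA, ← Real.sqrt_mul (by positivity)]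
      apply Real.le_sqrt_of_sq_le
      rw [div_mul_eq_mul_div, le_div_iff₀ (by positivity)]
      linarith
    refine ⟨hℓ1, hℓA, ?_⟩
    have hls := large_sieve ε hε ℓ k ⌊x⌋₊ hℓ1 B (fun p hp => (hBp p hp).1)
      (fun p hp => (hBp p hp).2) ?_ (Cη ^ k * (A ^ ((1 : ℝ) / 6) * x ^ ((1 : ℝ) / 12))) ?_
    · have hcount : (B.card : ℝ) ≤ K * x ^ ((1 : ℝ) / 12) := by
        rw [← le_div_iff₀ (by positivity)] at hls
        refine hls.trans (le_of_eq ?_)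
        rw [hK]; ring
      have hpx := hpi x hx3
      rw [Pdens, ← hB]
      calc (B.card : ℝ) / piOdd x ≤ (K * x ^ ((1 : ℝ) / 12)) / (c * x ^ ((11 : ℝ) / 12)) := by
            gcongr
        _ = K / c * (x ^ ((1 : ℝ) / 12) / x ^ ((11 : ℝ) / 12)) := by
            rw [mul_div_mul_comm]
        _ = _ := by
            rw [← Real.rpow_sub hx0]; norm_num
    · have : ((⌊x⌋₊ : ℝ)) ^ 3 ≤ (ℓ : ℝ) ^ k := by
        calc ((⌊x⌋₊ : ℝ)) ^ 3 ≤ x ^ 3 := by gcongr; exact Nat.floor_le hx0.le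
          _ = x ^ (3 : ℝ) := by norm_cast
          _ ≤ x ^ (θ * k) := Real.rpow_le_rpow_of_exponent_le (by linarith) hk3
          _ = (x ^ θ) ^ k := by rw [Real.rpow_mul hx0.le, Real.rpow_natCast]
          _ ≤ _ := by gcongr
      exact_mod_cast this
    · intro u hu
      rw [Finset.mem_Icc] at hu
      have huR : (u : ℝ) ≤ (ℓ : ℝ) ^ k := by exact_mod_cast hu.2
      calc (u.divisors.card : ℝ) ^ k ≤ (Cη * (u : ℝ) ^ (1 / (6 * (k : ℝ) ^ 2))) ^ k := by
            gcongr; exact hdiv u (by omega)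
        _ ≤ (Cη * ((ℓ : ℝ) ^ k) ^ (1 / (6 * (k : ℝ) ^ 2))) ^ k := by gcongr
        _ = Cη ^ k * (ℓ : ℝ) ^ ((1 : ℝ) / 6) := by
            rw [mul_pow]; congr 1
            rw [← Real.rpow_natCast, ← Real.rpow_natCast, ← Real.rpow_mul hℓ0.le,
              ← Real.rpow_mul hℓ0.le]
            congr 1; field_simp
        _ ≤ Cη ^ k * (A * √x) ^ ((1 : ℝ) / 6) := by gcongr
        _ = _ := by
            rw [Real.mul_rpow hA0.le (Real.sqrt_nonneg _), Real.sqrt_eq_rpow, ← Real.rpow_mul hx0.le]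
            norm_num
  rw [tsum_eq_sum (s := Icc 1 ⌊A * √x⌋₊)]
  · calc _ ≤ ∑ ℓ ∈ Icc 1 ⌊A * √x⌋₊, K / c * x ^ (-((5 : ℝ) / 6)) := by
          refine Finset.sum_le_sum fun ℓ _ => ?_
          have h0 : 0 ≤ K / c * x ^ (-((5 : ℝ) / 6)) := by positivity
          split_ifs with h
          · by_cases hP : Pdens ε ℓ x = 0
            · rw [hP]; exact h0
            · exact (hlarge ℓ h hP).2.2
          · exact h0
      _ = (⌊A * √x⌋₊ : ℝ) * (K / c * x ^ (-((5 : ℝ) / 6))) := by simp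
      _ ≤ (A * √x) * (K / c * x ^ (-((5 : ℝ) / 6))) := by
          gcongr; exact Nat.floor_le (by positivity)
      _ = A * (K / c) * (x ^ ((1 : ℝ) / 2) * x ^ (-((5 : ℝ) / 6))) := by
          rw [Real.sqrt_eq_rpow]; ring
      _ = A * (K / c) * x ^ (-((1 : ℝ) / 3)) := by
          rw [← Real.rpow_add hx0]; norm_num
      _ ≤ _ := by
          gcongr
          · linarith
          · linarith
  · intro ℓ hℓ
    split_ifs with h
    · by_contra hP
      obtain ⟨a, b, _⟩ := hlarge ℓ h hP
      exact hℓ (Finset.mem_Icc.2 ⟨a, Nat.le_floor b⟩)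
    · rfl

end
end

section
/- Let q_1, …, q_r be distinct primes and let η_1, …, η_r ∈ {±1}. Then, as x → ∞, #{primes p ≤ x : p ∉ {q_1,…,q_r}, (q_i/p) = η_i for all 1 ≤ i ≤ r} = 2^{−r} π(x) + o(π(x)), where (q_i/p) denotes the Legendre symbol modulo p and π(x) is the prime-counting function. -/
open Finset Filter

noncomputable section

namespace WI
open MeasureTheory Topology Complex

/-- inverse Fourier kernel -/
def kerOf (φ : ℝ → ℂ) (x : ℝ) : ℂ := ∫ t : ℝ, φ t * cexp (I * t * x)

lemma riemann_lebesgue (g : ℝ → ℂ) :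
    Tendsto (fun v : ℝ => ∫ t : ℝ, g t * cexp (I * t * v)) atTop (𝓝 0) := by
  have h := Real.tendsto_integral_exp_smul_cocompact g
  have h2 : Tendsto (fun v : ℝ => -(v / (2 * Real.pi))) atTop (cocompact ℝ) := by
    refine Tendsto.mono_right ?_ atBot_le_cocompact
    exact tendsto_neg_atTop_atBot.comp (tendsto_id.atTop_div_const (by positivity))
  refine (h.comp h2).congr fun v => ?_
  simp only [Function.comp]
  refine integral_congr_ae (Eventually.of_forall fun t => ?_)
  simp only [Circle.smul_def, Real.fourierChar_apply, smul_eq_mul]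
  rw [mul_comm]
  congr 2
  push_cast
  have : (Real.pi : ℂ) ≠ 0 := by exact_mod_cast Real.pi_ne_zero
  field_simp

lemma fubini_step (φ : ℝ → ℂ) (hφ : Continuous φ) (hc : HasCompactSupport φ)
    (f : ℝ → ℝ) (hf : Measurable f) (C : ℝ) (hC : ∀ u, |f u| ≤ C) (ε : ℝ) (hε : 0 < ε) (v : ℝ) :
    ∫ u in Set.Ioi (0:ℝ), (f u : ℂ) * cexp (-(ε * u : ℝ)) * kerOf φ (v - u) =
    ∫ t : ℝ, φ t * cexp (I * t * v) * ∫ u in Set.Ioi (0:ℝ), (f u : ℂ) * cexp (-((ε + I * t) * u)) := by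
  unfold kerOf
  simp_rw [← integral_const_mul]
  rw [integral_integral_swap]
  · refine integral_congr_ae (Eventually.of_forall fun t => ?_)
    refine integral_congr_ae (Eventually.of_forall fun u => ?_)
    simp only
    have : cexp (I * t * (v - u : ℝ)) * cexp (-(ε * u : ℝ)) = cexp (I * t * v) * cexp (-((ε + I * t) * u)) := by
      rw [← Complex.exp_add, ← Complex.exp_add]; congr 1; push_cast; ring
    linear_combination (f u : ℂ) * φ t * this
  · have h1 : Integrable (fun u : ℝ => C * Real.exp (-ε * u)) (volume.restrict (Set.Ioi 0)) :=
      (integrableOn_exp_mul_Ioi (by linarith) 0).const_mul C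
    have h2 : Integrable φ := hφ.integrable_of_hasCompactSupport hc
    have h3 := h1.mul_prod h2.norm
    refine h3.mono' ?_ (Eventually.of_forall ?_)
    · apply Measurable.aestronglyMeasurable
      have := hφ.measurable
      unfold Function.uncurry
      fun_prop
    · rintro ⟨u, t⟩
      simp only [Function.uncurry, norm_mul, Complex.norm_exp, Complex.norm_real]
      have e1 : (I * (t:ℂ) * ((v - u : ℝ) : ℂ)).re = 0 := by simp
      have e2 : (-((ε * u : ℝ) : ℂ)).re = -ε * u := by rw [neg_re, ofReal_re]; ring
      rw [e1, e2, Real.exp_zero, mul_one]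
      gcongr
      exact hC u

lemma kerOf_continuous (φ : ℝ → ℂ) (hφ : Continuous φ) (hc : HasCompactSupport φ) :
    Continuous (kerOf φ) := by
  unfold kerOf
  refine continuous_of_dominated (bound := fun t => ‖φ t‖) ?_ ?_ ?_ ?_
  · intro x; exact (by fun_prop : Continuous _).aestronglyMeasurable
  · intro x; refine Eventually.of_forall fun t => ?_
    rw [norm_mul, Complex.norm_exp]; simp
  · exact (hφ.integrable_of_hasCompactSupport hc).norm
  · refine Eventually.of_forall fun t => ?_
    fun_prop

lemma conv_eq (φ : ℝ → ℂ) (hφ : Continuous φ) (hc : HasCompactSupport φ)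
    (hK : Integrable (kerOf φ))
    (f : ℝ → ℝ) (hf : Measurable f) (C : ℝ) (hC : ∀ u, |f u| ≤ C)
    (H : ℂ → ℂ) (hH : ContinuousOn H {s | 0 ≤ s.re})
    (hL : ∀ s : ℂ, 0 < s.re → ∫ u in Set.Ioi (0:ℝ), (f u : ℂ) * cexp (-(s * u)) = H s) (v : ℝ) :
    ∫ u in Set.Ioi (0:ℝ), (f u : ℂ) * kerOf φ (v - u) =
    ∫ t : ℝ, (φ t * H (I * t)) * cexp (I * t * v) := by
  have hlhs : Tendsto (fun ε : ℝ => ∫ u in Set.Ioi (0:ℝ), (f u : ℂ) * cexp (-(ε * u : ℝ)) * kerOf φ (v - u))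
      (𝓝[>] 0) (𝓝 (∫ u in Set.Ioi (0:ℝ), (f u : ℂ) * kerOf φ (v - u))) := by
    have hKm : Measurable (kerOf φ) := (kerOf_continuous φ hφ hc).measurable
    refine tendsto_integral_filter_of_dominated_convergence (fun u => C * ‖kerOf φ (v - u)‖) ?_ ?_ ?_ ?_
    · refine Eventually.of_forall fun ε => Measurable.aestronglyMeasurable ?_
      fun_prop
    · filter_upwards [self_mem_nhdsWithin] with ε hε
      filter_upwards [ae_restrict_mem measurableSet_Ioi] with u hu
      rw [norm_mul, norm_mul, Complex.norm_exp, Complex.norm_real, neg_re, ofReal_re]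
      have : Real.exp (-(ε * u)) ≤ 1 := by
        apply Real.exp_le_one_iff.2
        have := mul_pos (Set.mem_Ioi.1 hε) (Set.mem_Ioi.1 hu)
        linarith
      have h0 := hC u
      have : ‖f u‖ * Real.exp (-(ε * u)) ≤ C * 1 :=
        mul_le_mul h0 this (Real.exp_pos _).le ((abs_nonneg _).trans h0)
      rw [mul_one] at this
      gcongr
    · exact ((hK.comp_sub_left v).norm.const_mul C).integrableOn
    · refine Eventually.of_forall fun u => ?_
      have : Continuous (fun ε : ℝ => (f u : ℂ) * cexp (-(ε * u : ℝ)) * kerOf φ (v - u)) := by fun_prop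
      have h := this.tendsto 0
      simp only [zero_mul, ofReal_zero, neg_zero, Complex.exp_zero, mul_one] at h
      exact h.mono_left nhdsWithin_le_nhds
  have hrhs : Tendsto (fun ε : ℝ => ∫ t : ℝ, φ t * cexp (I * t * v) * H (ε + I * t))
      (𝓝[>] 0) (𝓝 (∫ t : ℝ, (φ t * H (I * t)) * cexp (I * t * v))) := by
    obtain ⟨R, hR⟩ := hc.isCompact.isBounded.subset_closedBall 0
    have hcomp : IsCompact ((fun p : ℝ × ℝ => ((p.1 : ℂ) + I * p.2)) '' (Set.Icc 0 1 ×ˢ Set.Icc (-R) R)) :=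
      (isCompact_Icc.prod isCompact_Icc).image (by fun_prop)
    obtain ⟨D, hD⟩ := hcomp.exists_bound_of_continuousOn (f := H) (hH.mono (by
      rintro _ ⟨⟨a, b⟩, ⟨ha, hb⟩, rfl⟩
      simpa using ha.1))
    have hsup : ∀ t, t ∉ Set.Icc (-R) R → φ t = 0 := by
      intro t ht
      by_contra h
      have := hR (subset_tsupport _ h)
      rw [Real.closedBall_eq_Icc] at this
      simp at this ht
      linarith [ht this.1]
    refine tendsto_integral_filter_of_dominated_convergence (fun t => ‖φ t‖ * D) ?_ ?_ ?_ ?_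
    · filter_upwards [self_mem_nhdsWithin] with ε hε
      apply Continuous.aestronglyMeasurable
      have : Continuous (fun t : ℝ => H (ε + I * t)) := by
        refine hH.comp_continuous (by fun_prop) fun t => ?_
        simpa using (Set.mem_Ioi.1 hε).le
      exact (hφ.mul (by fun_prop)).mul this
    · filter_upwards [Ioo_mem_nhdsGT (show (0:ℝ) < 1 by norm_num)] with ε hε
      refine Eventually.of_forall fun t => ?_
      rw [norm_mul, norm_mul, Complex.norm_exp]
      have e1 : (I * (t:ℂ) * (v : ℂ)).re = 0 := by simp
      rw [e1, Real.exp_zero, mul_one]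
      by_cases ht : t ∈ Set.Icc (-R) R
      · gcongr
        exact hD _ ⟨(ε, t), ⟨⟨hε.1.le, hε.2.le⟩, ht⟩, rfl⟩
      · simp [hsup t ht]
    · exact (hφ.integrable_of_hasCompactSupport hc).norm.mul_const D
    · refine Eventually.of_forall fun t => ?_
      have h1 : Tendsto (fun ε : ℝ => H (ε + I * t)) (𝓝[>] 0) (𝓝 (H (I * t))) := by
        have h2 := hH (I * t) (by simp)
        refine h2.tendsto.comp (tendsto_nhdsWithin_iff.2 ⟨?_, ?_⟩)
        · have : Continuous (fun ε : ℝ => (ε : ℂ) + I * t) := by fun_prop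
          have h := this.tendsto 0
          simp only [ofReal_zero, zero_add] at h
          exact h.mono_left nhdsWithin_le_nhds
        · filter_upwards [self_mem_nhdsWithin] with ε hε
          simpa using (Set.mem_Ioi.1 hε).le
      have := h1.const_mul (φ t * cexp (I * t * v))
      convert this using 2
      ring
  refine tendsto_nhds_unique (hlhs.congr' ?_) hrhs
  filter_upwards [self_mem_nhdsWithin] with ε hε
  rw [fubini_step φ hφ hc f hf C hC ε hε v]
  refine integral_congr_ae (Eventually.of_forall fun t => ?_)
  simp only
  rw [hL _ (by simpa using hε)]

lemma conv_tendsto (φ : ℝ → ℂ) (hφ : Continuous φ) (hc : HasCompactSupport φ)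
    (hK : Integrable (kerOf φ))
    (f : ℝ → ℝ) (hf : Measurable f) (C : ℝ) (hC : ∀ u, |f u| ≤ C)
    (H : ℂ → ℂ) (hH : ContinuousOn H {s | 0 ≤ s.re})
    (hL : ∀ s : ℂ, 0 < s.re → ∫ u in Set.Ioi (0:ℝ), (f u : ℂ) * cexp (-(s * u)) = H s) :
    Tendsto (fun v : ℝ => ∫ u in Set.Ioi (0:ℝ), (f u : ℂ) * kerOf φ (v - u)) atTop (𝓝 0) := by
  simp_rw [conv_eq φ hφ hc hK f hf C hC H hH hL]
  exact riemann_lebesgue _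

def tri (t : ℝ) : ℂ := ((max 0 (1 - |t|) : ℝ) : ℂ)

lemma tri_cont : Continuous tri := by unfold tri; fun_prop

lemma tri_supp : HasCompactSupport tri := by
  refine HasCompactSupport.intro (K := Set.Icc (-1) 1) isCompact_Icc fun x hx => ?_
  unfold tri
  rw [max_eq_left]
  · simp
  · by_contra h
    apply hx
    rw [Set.mem_Icc, ← abs_le]
    linarith

def fej (x : ℝ) : ℝ := ∫ t in (0:ℝ)..1, (1 - t) * (2 * Real.cos (t * x))

lemma kerOf_tri (x : ℝ) : kerOf tri x = (fej x : ℂ) := by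
  unfold kerOf
  have hint : Integrable (fun t : ℝ => tri t * cexp (I * t * x)) := by
    apply Continuous.integrable_of_hasCompactSupport
    · have := tri_cont
      fun_prop
    · exact tri_supp.mul_right
  have h1 := integral_add_compl (measurableSet_Ioi (a := (0:ℝ))) hint
  rw [← h1, Set.compl_Ioi]
  have h2 := integral_comp_neg_Ioi 0 (fun t : ℝ => tri t * cexp (I * t * x))
  rw [neg_zero] at h2
  rw [← h2, ← integral_add hint.integrableOn hint.comp_neg.integrableOn]
  have h3 : Set.Ioi (0:ℝ) = Set.Ioc 0 1 ∪ Set.Ioi 1 := by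
    rw [Set.Ioc_union_Ioi_eq_Ioi zero_le_one]
  rw [setIntegral_eq_of_subset_of_forall_sdiff_eq_zero (s := Set.Ioc (0:ℝ) 1)
    measurableSet_Ioi Set.Ioc_subset_Ioi_self, ← intervalIntegral.integral_of_le zero_le_one]
  · unfold fej
    rw [← intervalIntegral.integral_ofReal]
    refine intervalIntegral.integral_congr fun t ht => ?_
    rw [Set.uIcc_of_le zero_le_one] at ht
    simp only [tri, abs_neg, abs_of_nonneg ht.1]
    rw [max_eq_right (by linarith [ht.2])]
    push_cast
    rw [Complex.cos]
    have e1 : I * (t:ℂ) * x = t * x * I := by ring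
    have e2 : I * (-t:ℂ) * x = -(t * x) * I := by ring
    rw [e1, e2]
    ring
  · rintro t ⟨ht0, ht1⟩
    have : 1 < t := by
      simp at ht0 ht1; exact ht1 ht0
    have h0 : max 0 (1 - |t|) = 0 := by
      rw [max_eq_left]; rw [abs_of_pos ht0]; linarith
    simp [tri, h0]

lemma fej_formula (x : ℝ) : x ^ 2 * fej x = 2 * (1 - Real.cos x) := by
  unfold fej
  rw [← intervalIntegral.integral_const_mul]
  have hd : ∀ t ∈ Set.uIcc (0:ℝ) 1, HasDerivAt
      (fun t => 2 * x * ((1 - t) * Real.sin (t * x)) - 2 * Real.cos (t * x))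
      (x ^ 2 * ((1 - t) * (2 * Real.cos (t * x)))) t := by
    intro t _
    have a1 : HasDerivAt (fun t : ℝ => t * x) x t := by simpa using (hasDerivAt_id t).mul_const x
    have a2 := (((hasDerivAt_id t).const_sub 1).mul a1.sin).const_mul (2 * x)
    have a3 := a2.sub (a1.cos.const_mul 2)
    refine a3.congr_deriv ?_
    simp
    ring
  rw [intervalIntegral.integral_eq_sub_of_hasDerivAt hd]
  · simp; ring
  · apply Continuous.intervalIntegrable; fun_prop

lemma fej_zero : fej 0 = 1 := by
  unfold fej
  have hd : ∀ t ∈ Set.uIcc (0:ℝ) 1, HasDerivAt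
      (fun t => 2 * t - t ^ 2) ((1 - t) * (2 * Real.cos (t * 0))) t := by
    intro t _
    have a3 := ((hasDerivAt_id t).const_mul 2).sub ((hasDerivAt_id t).pow 2)
    refine a3.congr_deriv ?_
    simp
    ring
  rw [intervalIntegral.integral_eq_sub_of_hasDerivAt hd]
  · norm_num
  · apply Continuous.intervalIntegrable; fun_prop

lemma fej_nonneg (x : ℝ) : 0 ≤ fej x := by
  rcases eq_or_ne x 0 with rfl | hx
  · rw [fej_zero]; norm_num
  · have h := fej_formula x
    have h2 := Real.cos_le_one x
    by_contra! h3
    have : 0 < x ^ 2 := by positivity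
    nlinarith

lemma fej_le_one (x : ℝ) : fej x ≤ 1 := by
  rcases eq_or_ne x 0 with rfl | hx
  · rw [fej_zero]
  · have h := fej_formula x
    have h2 := Real.one_sub_sq_div_two_le_cos (x := x)
    by_contra! h3
    have : 0 < x ^ 2 := by positivity
    nlinarith

lemma fej_cont : Continuous fej := by
  have h := kerOf_continuous tri tri_cont tri_supp
  have : fej = fun x => (kerOf tri x).re := by
    ext x; rw [kerOf_tri]; simp
  rw [this]
  fun_prop

lemma fej_int : Integrable fej := by
  refine (integrable_inv_one_add_sq.const_mul 5).mono' fej_cont.aestronglyMeasurable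
    (Eventually.of_forall fun x => ?_)
  rw [Real.norm_of_nonneg (fej_nonneg x), ← div_eq_mul_inv, le_div_iff₀ (by positivity)]
  have := fej_formula x
  have := fej_le_one x
  have := Real.neg_one_le_cos x
  nlinarith

lemma fej_pos : 0 < ∫ x, fej x := by
  rw [integral_pos_iff_support_of_nonneg fej_nonneg fej_int]
  refine IsOpen.measure_pos _ fej_cont.isOpen_support ⟨0, ?_⟩
  simp [fej_zero]

lemma kerOf_scale (l : ℝ) (hl : 0 < l) (x : ℝ) :
    kerOf (fun t => tri (t / l)) x = ((l * fej (l * x) : ℝ) : ℂ) := by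
  push_cast
  rw [← kerOf_tri]
  unfold kerOf
  have := Measure.integral_comp_div (fun t : ℝ => tri t * cexp (I * t * ((l * x : ℝ) : ℂ))) l
  rw [abs_of_pos hl, Complex.real_smul] at this
  rw [← this]
  refine integral_congr_ae (Eventually.of_forall fun t => ?_)
  simp only
  congr 2
  have : (l : ℂ) ≠ 0 := by exact_mod_cast hl.ne'
  push_cast
  field_simp

/-- smoothed averages converge -/
lemma avg_tendsto (B : ℝ → ℝ) (hB : Measurable B) (C c : ℝ)
    (hBC : ∀ u, |B u| ≤ C) (hB0 : ∀ u < 0, B u = 0)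
    (H : ℂ → ℂ) (hH : ContinuousOn H {s | 0 ≤ s.re})
    (hL : ∀ s : ℂ, 0 < s.re →
      ∫ u in Set.Ioi (0:ℝ), ((B u - c : ℝ) : ℂ) * cexp (-(s * u)) = H s)
    (d : ℝ) (hd : 0 < d) :
    Tendsto (fun v : ℝ => ∫ w, B (v - d * w) * fej w) atTop (𝓝 (c * ∫ w, fej w)) := by
  have hl : 0 < d⁻¹ := inv_pos.2 hd
  have hK : Integrable (kerOf (fun t => tri (t / d⁻¹))) := by
    have : kerOf (fun t => tri (t / d⁻¹)) = fun x => ((d⁻¹ * fej (d⁻¹ * x) : ℝ) : ℂ) := by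
      ext x; exact kerOf_scale _ hl x
    rw [this]
    exact ((fej_int.comp_mul_left' hl.ne').const_mul _).ofReal
  have hcs : HasCompactSupport (fun t => tri (t / d⁻¹)) := by
    have := tri_supp.comp_homeomorph (Homeomorph.mulRight₀ d hd.ne')
    convert this using 2 with t
    simp
  have h1 := conv_tendsto (fun t => tri (t / d⁻¹)) (tri_cont.comp (by fun_prop)) hcs hK
    (fun u => B u - c) (hB.sub_const c) (C + |c|)
    (fun u => (abs_sub _ _).trans (by gcongr; exact hBC u)) H hH hL
  simp_rw [kerOf_scale _ hl, ← ofReal_mul] at h1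
  have h2 : Tendsto (fun v : ℝ => ∫ u in Set.Ioi (0:ℝ), (B u - c) * (d⁻¹ * fej (d⁻¹ * (v - u)))) atTop (𝓝 0) := by
    have := (continuous_re.tendsto 0).comp h1
    simp only [Function.comp_def, zero_re] at this
    refine this.congr fun v => ?_
    rw [integral_complex_ofReal, ofReal_re]
  -- integrability
  have hint : ∀ v, Integrable (fun u => d⁻¹ * fej (d⁻¹ * (v - u))) := fun v =>
    ((fej_int.comp_mul_left' hl.ne').comp_sub_left v).const_mul _
  have hBint : ∀ v, Integrable (fun u => B u * (d⁻¹ * fej (d⁻¹ * (v - u)))) := fun v =>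
    (hint v).bdd_mul hB.aestronglyMeasurable (Eventually.of_forall fun u => hBC u)
  have h3 : Tendsto (fun v : ℝ => ∫ u in Set.Ioi (0:ℝ), (d⁻¹ * fej (d⁻¹ * (v - u)))) atTop
      (𝓝 (∫ w, fej w)) := by
    have e : ∀ v : ℝ, ∫ u in Set.Ioi (0:ℝ), (d⁻¹ * fej (d⁻¹ * (v - u))) =
        ∫ w, (Set.Iio v).indicator (fun w => d⁻¹ * fej (d⁻¹ * w)) w := by
      intro v
      rw [← integral_indicator measurableSet_Ioi,
        ← integral_sub_left_eq_self (fun w => (Set.Iio v).indicator (fun w => d⁻¹ * fej (d⁻¹ * w)) w) volume v]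
      congr 1
      ext u
      simp [Set.indicator]
    have e2 : ∫ w, fej w = ∫ w, d⁻¹ * fej (d⁻¹ * w) := by
      rw [integral_const_mul, Measure.integral_comp_mul_left]
      simp [abs_of_pos hd, hd.ne']
    simp_rw [e, e2]
    have hI : Integrable (fun w => d⁻¹ * fej (d⁻¹ * w)) := (fej_int.comp_mul_left' hl.ne').const_mul _
    refine tendsto_integral_filter_of_dominated_convergence (fun w => ‖d⁻¹ * fej (d⁻¹ * w)‖) ?_ ?_ hI.norm ?_
    · exact Eventually.of_forall fun v => hI.aestronglyMeasurable.indicator measurableSet_Iio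
    · exact Eventually.of_forall fun v => Eventually.of_forall fun w => norm_indicator_le_norm_self _ _
    · refine Eventually.of_forall fun w => tendsto_const_nhds.congr' ?_
      filter_upwards [eventually_gt_atTop w] with v hv
      rw [Set.indicator_of_mem]
      exact hv
  have h4 := h2.add (h3.const_mul c)
  rw [zero_add] at h4
  refine h4.congr fun v => ?_
  rw [← integral_const_mul, ← integral_add]
  · have e1 : ∫ u in Set.Ioi (0:ℝ), ((B u - c) * (d⁻¹ * fej (d⁻¹ * (v - u))) + c * (d⁻¹ * fej (d⁻¹ * (v - u))))
        = ∫ u, B u * (d⁻¹ * fej (d⁻¹ * (v - u))) := by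
      rw [← integral_Ici_eq_integral_Ioi]
      rw [← setIntegral_eq_integral_of_forall_compl_eq_zero (s := Set.Ici (0:ℝ))
        (f := fun u => B u * (d⁻¹ * fej (d⁻¹ * (v - u))))]
      · congr 1; ext u; ring
      · intro u hu
        rw [hB0 u (by simpa using hu), zero_mul]
    rw [e1]
    rw [← integral_sub_left_eq_self _ volume v]
    have := Measure.integral_comp_mul_left (fun w => B (v - w) * (fej (d⁻¹ * (v - (v - w))))) d
    have e3 : ∀ w, d⁻¹ * (v - (v - d * w)) = w := fun w => by field_simp; ring
    simp only [e3] at this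
    rw [this, abs_of_pos hl, smul_eq_mul, ← integral_const_mul]
    congr 1; ext w; ring
  · exact (((hBint v).sub ((hint v).const_mul c)).congr
      (Eventually.of_forall fun u => by simp only [Pi.sub_apply]; ring)).integrableOn
  · exact ((hint v).const_mul c).integrableOn

lemma tail_small (η : ℝ) (hη : 0 < η) : ∃ a : ℝ, 0 < a ∧
    ∫ w in (Set.Icc (-a) a)ᶜ, fej w ≤ η := by
  have h : Tendsto (fun a : ℝ => ∫ w, (Set.Icc (-a) a)ᶜ.indicator fej w) atTop (𝓝 (∫ w : ℝ, (0:ℝ))) := by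
    refine tendsto_integral_filter_of_dominated_convergence (fun w => ‖fej w‖) ?_ ?_ fej_int.norm ?_
    · exact Eventually.of_forall fun v => fej_int.aestronglyMeasurable.indicator measurableSet_Icc.compl
    · exact Eventually.of_forall fun v => Eventually.of_forall fun w => norm_indicator_le_norm_self _ _
    · refine Eventually.of_forall fun w => tendsto_const_nhds.congr' ?_
      filter_upwards [eventually_ge_atTop |w|] with v hv
      rw [Set.indicator_of_notMem]
      simpa using abs_le.1 hv
  rw [integral_zero] at h
  obtain ⟨a, ha, ha'⟩ := ((h.eventually (eventually_le_nhds hη)).and (eventually_gt_atTop 0)).exists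
  refine ⟨a, ha', ?_⟩
  rwa [integral_indicator measurableSet_Icc.compl] at ha

lemma tauber (B : ℝ → ℝ) (hB : Measurable B) (C c : ℝ)
    (hBC : ∀ u, B u ≤ C) (hBnn : ∀ u, 0 ≤ B u) (hB0 : ∀ u < 0, B u = 0)
    (hmono : Monotone (fun u => B u * Real.exp u))
    (H : ℂ → ℂ) (hH : ContinuousOn H {s | 0 ≤ s.re})
    (hL : ∀ s : ℂ, 0 < s.re →
      ∫ u in Set.Ioi (0:ℝ), ((B u - c : ℝ) : ℂ) * cexp (-(s * u)) = H s) :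
    Tendsto B atTop (𝓝 c) := by
  have hBabs : ∀ u, |B u| ≤ C := fun u => by rw [abs_of_nonneg (hBnn u)]; exact hBC u
  have hC : 0 ≤ C := (hBnn 0).trans (hBC 0)
  set M := ∫ w, fej w with hM
  have hMpos : 0 < M := fej_pos
  have hshift : ∀ x y : ℝ, x ≤ y → B x ≤ B y * Real.exp (y - x) := by
    intro x y hxy
    have := hmono hxy
    simp only at this
    rw [Real.exp_sub, ← mul_div_assoc, le_div_iff₀ (Real.exp_pos _)]
    exact this
  have key : ∀ η : ℝ, 0 < η → η < 1 → ∀ᶠ v in atTop,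
      B v ≤ (1 + η) * (c + η) / (1 - η) ∧ (c - η - C * η) / (1 + η) ≤ B v := by
    intro η hη hη1
    obtain ⟨a, ha, hatail⟩ := tail_small (η * M) (by positivity)
    obtain ⟨d, hd, hde⟩ : ∃ d : ℝ, 0 < d ∧ Real.exp (2 * a * d) ≤ 1 + η := by
      refine ⟨Real.log (1 + η) / (2 * a), ?_, ?_⟩
      · have := Real.log_pos (show 1 < 1 + η by linarith)
        positivity
      · rw [mul_div_cancel₀ _ (by positivity), Real.exp_log (by positivity)]
    have hF := avg_tendsto B hB C c hBabs hB0 H hH hL d hd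
    set F := fun v : ℝ => ∫ w, B (v - d * w) * fej w with hFdef
    have hint : ∀ v, Integrable (fun w => B (v - d * w) * fej w) := fun v =>
      fej_int.bdd_mul (hB.comp (by fun_prop)).aestronglyMeasurable
        (Eventually.of_forall fun u => hBabs _)
    have hsplit : (∫ w in Set.Icc (-a) a, fej w) + ∫ w in (Set.Icc (-a) a)ᶜ, fej w = M :=
      integral_add_compl measurableSet_Icc fej_int
    have htail0 : 0 ≤ ∫ w in (Set.Icc (-a) a)ᶜ, fej w := integral_nonneg fej_nonneg
    have hcent0 : 0 ≤ ∫ w in Set.Icc (-a) a, fej w := integral_nonneg fej_nonneg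
    have hup : Tendsto (fun v => F (v + a * d)) atTop (𝓝 (c * M)) :=
      hF.comp (tendsto_atTop_add_const_right _ _ tendsto_id)
    have hlo : Tendsto (fun v => F (v - a * d)) atTop (𝓝 (c * M)) :=
      hF.comp (tendsto_atTop_add_const_right _ (-(a * d)) tendsto_id)
    have l1 : c * M < (c + η) * M := by nlinarith
    have l2 : (c - η) * M < c * M := by nlinarith
    filter_upwards [hup.eventually (eventually_le_nhds l1), hlo.eventually (eventually_ge_nhds l2)]
      with v hv1 hv2
    constructor
    · have hs : B v / (1 + η) * ((1 - η) * M) ≤ F (v + a * d) := by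
        have s1 : B v / (1 + η) * ((1 - η) * M) ≤ B v / (1 + η) * ∫ w in Set.Icc (-a) a, fej w := by
          have := hBnn v
          gcongr
          linarith
        refine s1.trans ?_
        rw [← integral_const_mul]
        refine (setIntegral_mono_on (fej_int.const_mul _).integrableOn (hint (v + a * d)).integrableOn
          measurableSet_Icc ?_).trans (setIntegral_le_integral (hint _)
            (Eventually.of_forall fun w => mul_nonneg (hBnn _) (fej_nonneg _)))
        intro w hw
        have := hshift v (v + a * d - d * w) (by nlinarith [hw.2])
        have e : Real.exp (v + a * d - d * w - v) ≤ 1 + η :=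
          (Real.exp_le_exp.2 (by nlinarith [hw.1])).trans hde
        have h0 := hBnn (v + a * d - d * w)
        refine mul_le_mul_of_nonneg_right ?_ (fej_nonneg w)
        rw [div_le_iff₀ (by positivity)]
        nlinarith
      have h5 := hs.trans hv1
      rw [← mul_assoc] at h5
      have h6 := le_of_mul_le_mul_right h5 hMpos
      rw [le_div_iff₀ (by linarith)]
      rw [div_mul_eq_mul_div, div_le_iff₀ (by linarith)] at h6
      linarith
    · have hs : F (v - a * d) ≤ B v * (1 + η) * M + C * (η * M) := by
        have := integral_add_compl (measurableSet_Icc (a := -a) (b := a)) (hint (v - a * d))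
        rw [hFdef]
        simp only
        rw [← this]
        refine add_le_add ?_ ?_
        · have s1 : B v * (1 + η) * ∫ w in Set.Icc (-a) a, fej w ≤ B v * (1 + η) * M := by
            have := hBnn v
            gcongr
            linarith
          refine le_trans ?_ s1
          rw [← integral_const_mul]
          refine setIntegral_mono_on (hint (v - a * d)).integrableOn (fej_int.const_mul _).integrableOn
            measurableSet_Icc ?_
          intro w hw
          have := hshift (v - a * d - d * w) v (by nlinarith [hw.1])
          have e : Real.exp (v - (v - a * d - d * w)) ≤ 1 + η :=
            (Real.exp_le_exp.2 (by nlinarith [hw.2])).trans hde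
          have h0 := hBnn v
          refine mul_le_mul_of_nonneg_right ?_ (fej_nonneg w)
          nlinarith
        · refine le_trans ?_ (mul_le_mul_of_nonneg_left hatail hC)
          rw [← integral_const_mul]
          refine setIntegral_mono_on (hint (v - a * d)).integrableOn (fej_int.const_mul _).integrableOn
            measurableSet_Icc.compl ?_
          intro w hw
          exact mul_le_mul_of_nonneg_right (hBC _) (fej_nonneg w)
      rw [div_le_iff₀ (by linarith)]
      have : (c - η) * M ≤ (B v * (1 + η) + C * η) * M := by linarith
      have := le_of_mul_le_mul_right this hMpos
      linarith
  have hsmall : ∀ᶠ η : ℝ in 𝓝[>] 0, 0 < η ∧ η < 1 := Ioo_mem_nhdsGT one_pos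
  rw [tendsto_order]
  constructor
  · intro b hb
    have : Tendsto (fun η : ℝ => (c - η - C * η) / (1 + η)) (𝓝[>] 0) (𝓝 c) := by
      have h : ContinuousAt (fun η : ℝ => (c - η - C * η) / (1 + η)) 0 :=
        ContinuousAt.div (by fun_prop) (by fun_prop) (by norm_num)
      have h := h.tendsto
      simp only [sub_zero, mul_zero, add_zero, div_one] at h
      exact h.mono_left nhdsWithin_le_nhds
    obtain ⟨η, h1, h2, h3⟩ := ((this.eventually (lt_mem_nhds hb)).and hsmall).exists
    filter_upwards [key η h2 h3] with v hv
    linarith [hv.2]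
  · intro b hb
    have : Tendsto (fun η : ℝ => (1 + η) * (c + η) / (1 - η)) (𝓝[>] 0) (𝓝 c) := by
      have h : ContinuousAt (fun η : ℝ => (1 + η) * (c + η) / (1 - η)) 0 :=
        ContinuousAt.div (by fun_prop) (by fun_prop) (by norm_num)
      have h := h.tendsto
      simp only [sub_zero, one_mul, add_zero, div_one] at h
      exact h.mono_left nhdsWithin_le_nhds
    obtain ⟨η, h1, h2, h3⟩ := ((this.eventually (gt_mem_nhds hb)).and hsmall).exists
    filter_upwards [key η h2 h3] with v hv
    linarith [hv.1]

open ArithmeticFunction.vonMangoldt in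
def psiA {q : ℕ} (a : ZMod q) (x : ℝ) : ℝ := ∑ k ∈ Finset.Icc 1 ⌊x⌋₊, residueClass a k

lemma psiA_nonneg {q : ℕ} (a : ZMod q) (x : ℝ) : 0 ≤ psiA a x :=
  Finset.sum_nonneg fun _ _ => ArithmeticFunction.vonMangoldt.residueClass_nonneg a _

lemma psiA_mono {q : ℕ} (a : ZMod q) : Monotone (psiA a) := by
  intro x y h
  refine Finset.sum_le_sum_of_subset_of_nonneg (Finset.Icc_subset_Icc_right (Nat.floor_mono h))
    fun _ _ _ => ArithmeticFunction.vonMangoldt.residueClass_nonneg a _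

lemma psiA_le {q : ℕ} (a : ZMod q) (x : ℝ) (hx : 0 ≤ x) : psiA a x ≤ (Real.log 4 + 4) * x := by
  refine le_trans ?_ (Chebyshev.psi_le_const_mul_self hx)
  exact Finset.sum_le_sum fun _ _ => ArithmeticFunction.vonMangoldt.residueClass_le a _

lemma psiA_laplace {q : ℕ} (a : ZMod q) (s : ℂ) (hs : 0 < s.re) :
    LSeries (fun n => (ArithmeticFunction.vonMangoldt.residueClass a n : ℂ)) (s + 1) =
    (s + 1) * ∫ u in Set.Ioi (0:ℝ), ((psiA a (Real.exp u) * Real.exp (-u) : ℝ) : ℂ) * cexp (-(s * u)) := by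
  rw [LSeries_eq_mul_integral_of_nonneg (ArithmeticFunction.vonMangoldt.residueClass a) (r := 1)
    zero_le_one (by simpa using hs) ?_ (ArithmeticFunction.vonMangoldt.residueClass_nonneg a)]
  · congr 1
    have himg : Set.Ioi (1:ℝ) = Real.exp '' Set.Ioi 0 := by
      ext x
      constructor
      · intro hx
        exact ⟨Real.log x, Real.log_pos hx, Real.exp_log (zero_lt_one.trans hx)⟩
      · rintro ⟨u, hu, rfl⟩
        exact Real.one_lt_exp_iff.2 hu
    rw [himg, integral_image_eq_integral_abs_deriv_smul measurableSet_Ioi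
      (fun x _ => (Real.hasDerivAt_exp x).hasDerivWithinAt) Real.exp_injective.injOn]
    refine integral_congr_ae (Eventually.of_forall fun u => ?_)
    simp only [abs_of_pos (Real.exp_pos u), Complex.real_smul]
    rw [Complex.cpow_def_of_ne_zero (by exact_mod_cast (Real.exp_pos u).ne'), ← Complex.ofReal_log (Real.exp_pos u).le,
      Real.log_exp, ← Complex.ofReal_sum]
    change _ * ((psiA a (Real.exp u) : ℂ) * _) = _
    push_cast
    have : cexp u * cexp (u * -(s + 1 + 1)) = cexp (-u) * cexp (-(s * u)) := by
      rw [← Complex.exp_add, ← Complex.exp_add]; congr 1; ring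
    linear_combination (psiA a (Real.exp u) : ℂ) * this
  · refine Asymptotics.IsBigO.of_bound (Real.log 4 + 4) (Eventually.of_forall fun n => ?_)
    have h := psiA_le a n (Nat.cast_nonneg n)
    have h0 := psiA_nonneg a n
    unfold psiA at h h0
    rw [Nat.floor_natCast] at h h0
    rw [Real.norm_of_nonneg h0]
    simpa using h

lemma psiA_tendsto_exp {q : ℕ} [NeZero q] {a : ZMod q} (ha : IsUnit a) :
    Tendsto (fun u => psiA a (Real.exp u) * Real.exp (-u)) atTop (𝓝 ((q.totient : ℝ)⁻¹)) := by
  have hle : ∀ u, psiA a (Real.exp u) * Real.exp (-u) ≤ Real.log 4 + 4 := by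
    intro u
    have := psiA_le a (Real.exp u) (Real.exp_pos u).le
    rw [Real.exp_neg, ← div_eq_mul_inv, div_le_iff₀ (Real.exp_pos u)]
    exact this
  have hnn : ∀ u, 0 ≤ psiA a (Real.exp u) * Real.exp (-u) := fun u =>
    mul_nonneg (psiA_nonneg _ _) (Real.exp_pos _).le
  have hmeas : Measurable (fun u => psiA a (Real.exp u) * Real.exp (-u)) :=
    ((psiA_mono a).measurable.comp Real.measurable_exp).mul (by fun_prop)
  refine tauber _ hmeas (Real.log 4 + 4) _ hle hnn ?_ ?_
    (fun s => (ArithmeticFunction.vonMangoldt.LFunctionResidueClassAux a (s + 1) - (q.totient : ℂ)⁻¹) / (s + 1)) ?_ ?_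
  · intro u hu
    have : ⌊Real.exp u⌋₊ = 0 := Nat.floor_eq_zero.2 (by rw [← Real.exp_zero]; exact Real.exp_lt_exp.2 hu)
    simp [psiA, this]
  · intro x y hxy
    simp only [mul_assoc, ← Real.exp_add, neg_add_cancel, Real.exp_zero, mul_one]
    exact psiA_mono a (Real.exp_le_exp.2 hxy)
  · refine ContinuousOn.div (ContinuousOn.sub ?_ continuousOn_const) (by fun_prop) ?_
    · refine (ArithmeticFunction.vonMangoldt.continuousOn_LFunctionResidueClassAux a).comp (by fun_prop) ?_
      intro s hs
      simpa using hs
    · intro s hs h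
      have := congrArg Complex.re h
      simp at this hs
      linarith
  · intro s hs
    have h1 := psiA_laplace a s hs
    have h2 := ArithmeticFunction.vonMangoldt.eqOn_LFunctionResidueClassAux ha
      (show (s + 1) ∈ {s : ℂ | 1 < s.re} by simpa using hs)
    simp only at h2
    have h3 : IntegrableOn (fun u : ℝ => cexp (-(s * u))) (Set.Ioi 0) := by
      have := integrableOn_exp_mul_complex_Ioi (a := -s) (by simpa using hs) 0
      simpa using this
    have h4 : ∫ u : ℝ in Set.Ioi 0, cexp (-(s * u)) = 1 / s := by
      have := integral_exp_mul_complex_Ioi (a := -s) (by simpa using hs) 0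
      simpa using this
    have hs0 : s ≠ 0 := by rintro rfl; simp at hs
    have hs1 : s + 1 ≠ 0 := by
      intro h
      have := congrArg Complex.re h
      simp at this
      linarith
    have h5 : IntegrableOn (fun u : ℝ => ((psiA a (Real.exp u) * Real.exp (-u) : ℝ) : ℂ) * cexp (-(s * u))) (Set.Ioi 0) := by
      refine h3.bdd_mul (c := Real.log 4 + 4) (Complex.measurable_ofReal.comp hmeas).aestronglyMeasurable
        (Eventually.of_forall fun u => ?_)
      change ‖((psiA a (Real.exp u) * Real.exp (-u) : ℝ) : ℂ)‖ ≤ _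
      rw [Complex.norm_real, Real.norm_of_nonneg (hnn u)]
      exact hle u
    have h6 : ∫ u in Set.Ioi (0:ℝ), ((psiA a (Real.exp u) * Real.exp (-u) - (q.totient : ℝ)⁻¹ : ℝ) : ℂ) * cexp (-(s * u))
      = (∫ u in Set.Ioi (0:ℝ), ((psiA a (Real.exp u) * Real.exp (-u) : ℝ) : ℂ) * cexp (-(s * u))) - (q.totient : ℂ)⁻¹ * (1 / s) := by
      rw [← h4, ← integral_const_mul, ← integral_sub h5 (h3.const_mul _)]
      refine integral_congr_ae (Eventually.of_forall fun u => ?_)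
      simp only
      push_cast
      ring
    rw [h6, h2, h1]
    rw [add_sub_cancel_right]
    generalize (∫ u in Set.Ioi (0:ℝ), ((psiA a (Real.exp u) * Real.exp (-u) : ℝ) : ℂ) * cexp (-(s * u))) = Q
    generalize (q.totient : ℂ)⁻¹ = c
    field_simp
    ring

lemma psiA_tendsto {q : ℕ} [NeZero q] {a : ZMod q} (ha : IsUnit a) :
    Tendsto (fun x => psiA a x / x) atTop (𝓝 ((q.totient : ℝ)⁻¹)) := by
  refine ((psiA_tendsto_exp ha).comp Real.tendsto_log_atTop).congr' ?_
  filter_upwards [eventually_gt_atTop 0] with x hx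
  simp only [Function.comp]
  rw [Real.exp_neg, Real.exp_log hx, div_eq_mul_inv]

def piA {q : ℕ} (a : ZMod q) (x : ℝ) : ℝ :=
  (((Finset.range (⌊x⌋₊ + 1)).filter (fun p : ℕ => p.Prime ∧ (p : ZMod q) = a)).card : ℝ)

lemma filt_eq (P : ℕ → Prop) [DecidablePred P] (n : ℕ) :
    (Finset.range (n + 1)).filter (fun p => p.Prime ∧ P p) =
    ((Finset.Ioc 0 n).filter Nat.Prime).filter P := by
  ext p
  simp only [Finset.mem_filter, Finset.mem_range, Finset.mem_Ioc]
  constructor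
  · rintro ⟨h1, h2, h3⟩; exact ⟨⟨⟨h2.pos, by omega⟩, h2⟩, h3⟩
  · rintro ⟨⟨⟨h1, h2⟩, h3⟩, h4⟩; exact ⟨by omega, h3, h4⟩

def thetaA {q : ℕ} (a : ZMod q) (x : ℝ) : ℝ :=
  ∑ p ∈ ((Finset.Ioc 0 ⌊x⌋₊).filter Nat.Prime).filter (fun p : ℕ => (p : ZMod q) = a), Real.log p

lemma psiA_sub_thetaA {q : ℕ} (a : ZMod q) (x : ℝ) :
    0 ≤ psiA a x - thetaA a x ∧ psiA a x - thetaA a x ≤ Chebyshev.psi x - Chebyshev.theta x := by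
  have h : psiA a x - thetaA a x = ∑ n ∈ (Finset.Ioc 0 ⌊x⌋₊).filter (fun n => ¬ n.Prime),
      ArithmeticFunction.vonMangoldt.residueClass a n := by
    unfold psiA thetaA
    rw [show Finset.Icc 1 ⌊x⌋₊ = Finset.Ioc 0 ⌊x⌋₊ from rfl,
      ← Finset.sum_filter_add_sum_filter_not (Finset.Ioc 0 ⌊x⌋₊) Nat.Prime, Finset.sum_filter (fun p : ℕ => (p : ZMod q) = a)]
    rw [add_sub_right_comm, ← Finset.sum_sub_distrib, Finset.sum_eq_zero, zero_add]
    intro p hp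
    have := (Finset.mem_filter.1 hp).2
    by_cases hpa : (p : ZMod q) = a
    · simp [ArithmeticFunction.vonMangoldt.residueClass, Set.indicator, hpa, ArithmeticFunction.vonMangoldt_apply_prime this]
    · simp [ArithmeticFunction.vonMangoldt.residueClass, Set.indicator, hpa]
  rw [h, Chebyshev.psi_sub_theta_eq_sum_not_prime]
  exact ⟨Finset.sum_nonneg fun _ _ => ArithmeticFunction.vonMangoldt.residueClass_nonneg a _,
    Finset.sum_le_sum fun _ _ => ArithmeticFunction.vonMangoldt.residueClass_le a _⟩

lemma piA_sub_thetaA {q : ℕ} (a : ZMod q) (x : ℝ) (hx : 1 ≤ x) :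
    0 ≤ piA a x * Real.log x - thetaA a x ∧
    piA a x * Real.log x - thetaA a x ≤ (Nat.primeCounting ⌊x⌋₊ : ℝ) * Real.log x - Chebyshev.theta x := by
  have hnn : ∀ p ∈ (Finset.Ioc 0 ⌊x⌋₊).filter Nat.Prime, 0 ≤ Real.log x - Real.log p := by
    intro p hp
    simp only [Finset.mem_filter, Finset.mem_Ioc] at hp
    have h1 : (p : ℝ) ≤ x := (Nat.le_floor_iff (by linarith)).1 hp.1.2
    have h2 : (0:ℝ) < p := by exact_mod_cast hp.1.1
    linarith [Real.log_le_log h2 h1]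
  have h : piA a x * Real.log x - thetaA a x = ∑ p ∈ ((Finset.Ioc 0 ⌊x⌋₊).filter Nat.Prime).filter (fun p : ℕ => (p : ZMod q) = a),
      (Real.log x - Real.log p) := by
    unfold piA thetaA
    rw [filt_eq (fun p : ℕ => (p : ZMod q) = a)]
    rw [Finset.sum_sub_distrib, Finset.sum_const, nsmul_eq_mul]
  have h' : (Nat.primeCounting ⌊x⌋₊ : ℝ) * Real.log x - Chebyshev.theta x = ∑ p ∈ ((Finset.Ioc 0 ⌊x⌋₊).filter Nat.Prime),
      (Real.log x - Real.log p) := by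
    rw [Finset.sum_sub_distrib, Finset.sum_const, nsmul_eq_mul, Chebyshev.theta]
    congr 3
    rw [Nat.primeCounting, Nat.primeCounting', Nat.count_eq_card_filter_range]
    have := filt_eq (fun _ => True) ⌊x⌋₊
    simp only [and_true, Finset.filter_true] at this
    rw [this]
  rw [h, h']
  exact ⟨Finset.sum_nonneg fun p hp => hnn p (Finset.mem_of_mem_filter _ hp),
    Finset.sum_le_sum_of_subset_of_nonneg (Finset.filter_subset _ _) fun p hp _ => hnn p hp⟩

lemma piA_tendsto {q : ℕ} [NeZero q] {a : ZMod q} (ha : IsUnit a) :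
    Tendsto (fun x => piA a x * Real.log x / x) atTop (𝓝 ((q.totient : ℝ)⁻¹)) := by
  have t1 : Tendsto (fun x => (Chebyshev.psi x - Chebyshev.theta x) / x) atTop (𝓝 0) := by
    have h1 := Chebyshev.isBigO_psi_sub_theta_sqrt
    have h2 : (fun x : ℝ => Real.sqrt x) =o[atTop] (fun x : ℝ => x) := by
      rw [Asymptotics.isLittleO_iff_tendsto' (by
        filter_upwards [eventually_gt_atTop 0] with x hx h using absurd h hx.ne')]
      refine (tendsto_inv_atTop_zero.comp Real.tendsto_sqrt_atTop).congr fun x => ?_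
      simp only [Function.comp]
      rw [Real.sqrt_div_self', one_div]
    exact (h1.trans_isLittleO h2).tendsto_div_nhds_zero
  have t2 : Tendsto (fun x => ((Nat.primeCounting ⌊x⌋₊ : ℝ) * Real.log x - Chebyshev.theta x) / x) atTop (𝓝 0) := by
    have h1 := Chebyshev.primeCounting_sub_theta_div_log_isBigO
    have h2 : (fun x : ℝ => x / Real.log x ^ 2) =o[atTop] (fun x : ℝ => x / Real.log x) := by
      have h3 : (fun x : ℝ => (Real.log x)⁻¹) =o[atTop] (fun _ => (1:ℝ)) := by
        rw [Asymptotics.isLittleO_one_iff]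
        exact tendsto_inv_atTop_zero.comp Real.tendsto_log_atTop
      have := (Asymptotics.isBigO_refl (fun x : ℝ => x / Real.log x) atTop).mul_isLittleO h3
      refine this.congr (fun x => ?_) (fun x => by ring)
      rw [div_mul_eq_mul_div, ← div_eq_mul_inv, div_div, sq]
    refine (h1.trans_isLittleO h2).tendsto_div_nhds_zero.congr' ?_
    filter_upwards [eventually_gt_atTop 1] with x hx
    have : Real.log x ≠ 0 := (Real.log_pos hx).ne'
    field_simp
  have s1 : Tendsto (fun x => (psiA a x - thetaA a x) / x) atTop (𝓝 0) := by
    refine squeeze_zero' ?_ ?_ t1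
    · filter_upwards [eventually_gt_atTop 0] with x hx
      exact div_nonneg (psiA_sub_thetaA a x).1 hx.le
    · filter_upwards [eventually_gt_atTop 0] with x hx
      exact div_le_div_of_nonneg_right (psiA_sub_thetaA a x).2 hx.le
  have s2 : Tendsto (fun x => (piA a x * Real.log x - thetaA a x) / x) atTop (𝓝 0) := by
    refine squeeze_zero' ?_ ?_ t2
    · filter_upwards [eventually_ge_atTop 1] with x hx
      exact div_nonneg (piA_sub_thetaA a x hx).1 (by linarith)
    · filter_upwards [eventually_ge_atTop 1] with x hx
      exact div_le_div_of_nonneg_right (piA_sub_thetaA a x hx).2 (by linarith)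
  have := ((psiA_tendsto ha).sub s1).add s2
  simp only [sub_zero, add_zero] at this
  refine this.congr fun x => ?_
  ring

lemma piA_div_tendsto {q : ℕ} [NeZero q] {a : ZMod q} (ha : IsUnit a) :
    Tendsto (fun x : ℝ => piA a x / (((Finset.range (⌊x⌋₊ + 1)).filter Nat.Prime).card : ℝ)) atTop
      (𝓝 ((q.totient : ℝ)⁻¹)) := by
  have h1 := piA_tendsto ha
  have h2 := piA_tendsto (q := 1) (a := 1) isUnit_one
  have h3 := h1.div h2 (by simp)
  simp only [Nat.totient_one, Nat.cast_one, inv_one, div_one] at h3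
  refine h3.congr' ?_
  filter_upwards [eventually_gt_atTop 1] with x hx
  have e : piA (1 : ZMod 1) x = (((Finset.range (⌊x⌋₊ + 1)).filter Nat.Prime).card : ℝ) := by
    unfold piA
    congr 3
    ext p
    simp only [and_iff_left_iff_imp]
    intro _
    exact Subsingleton.elim _ _
  simp only [Pi.div_apply]
  rw [e]
  have : Real.log x ≠ 0 := (Real.log_pos hx).ne'
  have : x ≠ 0 := by linarith
  field_simp

lemma jac_mod (m N n : ℕ) (hm : 4 * m ∣ N) (hN : 2 ∣ N) (hn : Odd n) :
    jacobiSym m (n % N) = jacobiSym m n := by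
  have hodd : Odd (n % N) := by
    rw [Nat.odd_iff, Nat.mod_mod_of_dvd _ hN]; exact Nat.odd_iff.1 hn
  rw [jacobiSym.mod_right' m hodd, jacobiSym.mod_right' m hn, Nat.mod_mod_of_dvd _ hm]

lemma unit_odd (N : ℕ) [NeZero N] (hN : 2 ∣ N) (a : (ZMod N)ˣ) : Odd (a : ZMod N).val := by
  have h := ZMod.val_coe_unit_coprime a
  exact (Nat.Coprime.coprime_dvd_right hN h).odd_of_right

def jhom (m N : ℕ) [NeZero N] (hm : 4 * m ∣ N) (hN : 2 ∣ N) (hN1 : 1 < N) : (ZMod N)ˣ →* ℤ where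
  toFun a := jacobiSym m (a : ZMod N).val
  map_one' := by
    have : Fact (1 < N) := ⟨hN1⟩
    rw [Units.val_one, ZMod.val_one]; simp
  map_mul' a b := by
    rw [Units.val_mul, ZMod.val_mul, jac_mod m N _ hm hN ((unit_odd N hN a).mul (unit_odd N hN b))]
    exact jacobiSym.mul_right' _ (unit_odd N hN a).pos.ne' (unit_odd N hN b).pos.ne'

lemma jac_unit (m N : ℕ) [NeZero N] (hm : 4 * m ∣ N) (hN : 2 ∣ N) (a : (ZMod N)ˣ) (n : ℕ) (hn : Odd n)
    (h : (n : ZMod N) = a) : jacobiSym m (a : ZMod N).val = jacobiSym m n := by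
  rw [← h, ZMod.val_natCast, jac_mod m N n hm hN hn]

/-- local residue prescribing the symbol at an odd prime -/
lemma exists_local (q : ℕ) (hq : q.Prime) (h2 : q ≠ 2) (e : ℤ) (he : e = 1 ∨ e = -1) :
    ∃ c : ℕ, ∀ n : ℕ, n ≡ c [MOD q] → jacobiSym n q = e := by
  have : Fact q.Prime := ⟨hq⟩
  have : ∃ c : ℕ, jacobiSym c q = e := by
    rcases he with rfl | rfl
    · exact ⟨1, by simp⟩
    · obtain ⟨c, hc⟩ := FiniteField.exists_nonsquare (F := ZMod q) (by rwa [ZMod.ringChar_zmod_n])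
      refine ⟨c.val, ?_⟩
      rw [ZMod.nonsquare_iff_jacobiSym_eq_neg_one]
      simpa using hc
  obtain ⟨c, hc⟩ := this
  refine ⟨c, fun n hn => ?_⟩
  rw [← hc]
  apply jacobiSym.mod_left'
  exact_mod_cast hn

lemma exists_global {r : ℕ} (q : Fin r → ℕ) (hq : ∀ i, (q i).Prime)
    (hdist : Function.Injective q) (η : Fin r → ℤ) (hη : ∀ i, η i = 1 ∨ η i = -1) :
    ∃ n : ℕ, Odd n ∧ ∀ i, jacobiSym (q i) n = η i := by
  classical
  -- local data
  have hloc : ∀ i, ∃ c : ℕ, q i ≠ 2 → ∀ n : ℕ, n ≡ c [MOD q i] → jacobiSym n (q i) = η i := by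
    intro i
    by_cases h : q i = 2
    · exact ⟨0, fun h' => absurd h h'⟩
    · obtain ⟨c, hc⟩ := exists_local (q i) (hq i) h (η i) (hη i)
      exact ⟨c, fun _ => hc⟩
  choose c hc using hloc
  -- residue mod 8
  obtain ⟨e, he4, he⟩ : ∃ e : ℕ, e % 4 = 1 ∧ ∀ n : ℕ, n % 8 = e % 8 → ∀ i, q i = 2 → jacobiSym 2 n = η i := by
    by_cases h : ∃ i, q i = 2 ∧ η i = -1
    · obtain ⟨i, hi, hi'⟩ := h
      refine ⟨5, rfl, fun n hn j hj => ?_⟩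
      have : j = i := hdist (hj.trans hi.symm)
      subst this
      rw [hi', jacobiSym.at_two (Nat.odd_iff.2 (by omega)), ZMod.χ₈_nat_eq_if_mod_eight]
      have : n % 8 = 5 := hn
      have h2 : n % 2 = 1 := by omega
      simp [this, h2]
    · push Not at h
      refine ⟨1, rfl, fun n hn j hj => ?_⟩
      rw [(hη j).resolve_right (h j hj), jacobiSym.at_two (Nat.odd_iff.2 (by omega)), ZMod.χ₈_nat_eq_if_mod_eight]
      have : n % 8 = 1 := hn
      have h2 : n % 2 = 1 := by omega
      simp [this, h2]
  -- CRT
  let s : Option (Fin r) → ℕ := fun o => o.elim 8 (fun i => if q i = 2 then 1 else q i)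
  let a : Option (Fin r) → ℕ := fun o => o.elim e c
  have h8 : ∀ i, Nat.Coprime 8 (if q i = 2 then 1 else q i) := by
    intro i
    split_ifs with h
    · simp
    · rw [show 8 = 2 ^ 3 from rfl]
      exact Nat.Coprime.pow_left 3 ((Nat.coprime_primes Nat.prime_two (hq i)).2 (Ne.symm h))
  have hcop : Set.Pairwise (↑(Finset.univ : Finset (Option (Fin r)))) (fun i j => Nat.Coprime (s i) (s j)) := by
    rintro (_ | i) _ (_ | j) _ hij
    · exact absurd rfl hij
    · exact h8 j
    · exact (h8 i).symm
    · change Nat.Coprime (if q i = 2 then 1 else q i) (if q j = 2 then 1 else q j)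
      split_ifs
      · simp
      · simp
      · simp
      · exact (Nat.coprime_primes (hq i) (hq j)).2 fun h => hij (by rw [hdist h])
  have hs0 : ∀ i ∈ (Finset.univ : Finset (Option (Fin r))), s i ≠ 0 := by
    rintro (_ | i) _
    · change 8 ≠ 0; norm_num
    · change (if q i = 2 then 1 else q i) ≠ 0
      split_ifs
      · norm_num
      · exact (hq i).ne_zero
  obtain ⟨n, hn⟩ := Nat.chineseRemainderOfFinset a s Finset.univ hs0 hcop
  have hn8 : n % 8 = e % 8 := hn none (Finset.mem_univ _)
  have hodd : Odd n := Nat.odd_iff.2 (by omega)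
  refine ⟨n, hodd, fun i => ?_⟩
  by_cases h2 : q i = 2
  · rw [h2]; exact he n hn8 i h2
  · have hni := hn (some i) (Finset.mem_univ _)
    change n ≡ c i [MOD if q i = 2 then 1 else q i] at hni
    rw [if_neg h2] at hni
    rw [← hc i h2 n hni]
    exact jacobiSym.quadratic_reciprocity_one_mod_four' ((hq i).odd_of_ne_two h2) (by omega)

lemma card_fiber {r : ℕ} (q : Fin r → ℕ) (hq : ∀ i, (q i).Prime)
    (hdist : Function.Injective q) (η : Fin r → ℤ) (hη : ∀ i, η i = 1 ∨ η i = -1)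
    (N : ℕ) [NeZero N] (hN8 : N = 8 * ∏ i, q i) :
    (Finset.univ.filter (fun a : (ZMod N)ˣ => ∀ i, jacobiSym (q i) (a : ZMod N).val = η i)).card * 2 ^ r
      = N.totient := by
  classical
  have h4 : ∀ i, 4 * q i ∣ N := fun i => by
    rw [hN8]; exact mul_dvd_mul (by norm_num) (Finset.dvd_prod_of_mem q (Finset.mem_univ i))
  have h2 : 2 ∣ N := by rw [hN8]; exact Dvd.dvd.mul_right (by norm_num) _
  have hN1 : 1 < N := lt_of_lt_of_le (by norm_num) (Nat.le_of_dvd (Nat.pos_of_ne_zero (NeZero.ne N)) h2)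
  let Φ : (ZMod N)ˣ →* (Fin r → ℤ) := Pi.monoidHom (fun i => jhom (q i) N (h4 i) h2 hN1)
  have hΦ : ∀ a i, Φ a i = jacobiSym (q i) (a : ZMod N).val := fun a i => rfl
  have hT : ∀ e : Fin r → ℤ, e ∈ Fintype.piFinset (fun _ : Fin r => ({1, -1} : Finset ℤ)) ↔
      ∀ i, e i = 1 ∨ e i = -1 := by
    intro e; simp [Fintype.mem_piFinset]
  have hqN : ∀ i, q i ∣ N := fun i => (Dvd.intro_left 4 rfl).trans (h4 i)
  have hsurj : ∀ e : Fin r → ℤ, (∀ i, e i = 1 ∨ e i = -1) → e ∈ Set.range Φ := by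
    intro e he
    obtain ⟨n, hn, hne⟩ := exists_global q hq hdist e he
    have hcop : Nat.Coprime n N := by
      rw [hN8]
      refine Nat.Coprime.mul_right ?_ (Nat.Coprime.prod_right fun i _ => ?_)
      · rw [show 8 = 2 ^ 3 from rfl]
        exact Nat.Coprime.pow_right 3 (Nat.coprime_two_right.2 hn)
      · by_contra h
        have h0 : jacobiSym (q i) n = 0 := by
          rw [jacobiSym.eq_zero_iff]
          refine ⟨hn.pos.ne', ?_⟩
          rw [Int.gcd_natCast_natCast]
          intro h'
          exact h (Nat.Coprime.symm h')
        have := hne i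
        rcases he i with h1 | h1 <;> rw [h0, h1] at this <;> norm_num at this
    refine ⟨ZMod.unitOfCoprime n hcop, ?_⟩
    ext i
    rw [hΦ, jac_unit (q i) N (h4 i) h2 _ n hn (by simp), hne i]
  have hmaps : Set.MapsTo Φ (↑(Finset.univ : Finset (ZMod N)ˣ))
      (↑(Fintype.piFinset (fun _ : Fin r => ({1, -1} : Finset ℤ)))) := by
    intro a _
    rw [Finset.mem_coe, hT]
    intro i
    rw [hΦ]
    apply jacobiSym.eq_one_or_neg_one
    rw [Int.gcd_natCast_natCast]
    exact (Nat.Coprime.coprime_dvd_right (hqN i) (ZMod.val_coe_unit_coprime a)).symm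
  have hcard := Finset.card_eq_sum_card_fiberwise hmaps
  rw [Finset.sum_congr rfl (fun e he => MonoidHom.card_fiber_eq_of_mem_range Φ
    (hsurj e ((hT e).1 he)) (hsurj η hη)), Finset.sum_const, Fintype.card_piFinset,
    Finset.card_univ, ZMod.card_units_eq_totient] at hcard
  rw [hcard]
  simp only [Finset.prod_const, Finset.card_univ, Fintype.card_fin, smul_eq_mul]
  rw [mul_comm]
  congr 1
  congr 1
  ext a
  simp only [Finset.mem_filter, Finset.mem_univ, true_and]
  exact ⟨fun h => funext h, fun h i => congrFun h i⟩

theorem main (r : ℕ) (q : Fin r → ℕ) (hq : ∀ i, (q i).Prime)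
    (hdist : Function.Injective q) (η : Fin r → ℤ) (hη : ∀ i, η i = 1 ∨ η i = -1) :
    Filter.Tendsto (fun x : ℝ =>
      ((((Finset.range (⌊x⌋₊ + 1)).filter (fun p => p.Prime ∧ p ≠ 2 ∧ (∀ i, p ≠ q i) ∧
          ∀ i, jacobiSym (q i : ℤ) p = η i)).card : ℝ) /
        (((Finset.range (⌊x⌋₊ + 1)).filter Nat.Prime).card : ℝ)))
      Filter.atTop (nhds (1 / 2 ^ r)) := by
  classical
  obtain ⟨N, hN8⟩ : ∃ N, N = 8 * ∏ i, q i := ⟨_, rfl⟩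
  have hN0 : N ≠ 0 := by
    rw [hN8]
    exact mul_ne_zero (by norm_num) (Finset.prod_ne_zero_iff.2 fun i _ => (hq i).ne_zero)
  have : NeZero N := ⟨hN0⟩
  have h4 : ∀ i, 4 * q i ∣ N := fun i => by
    rw [hN8]; exact mul_dvd_mul (by norm_num) (Finset.dvd_prod_of_mem q (Finset.mem_univ i))
  have h2 : 2 ∣ N := by rw [hN8]; exact Dvd.dvd.mul_right (by norm_num) _
  have hqN : ∀ i, q i ∣ N := fun i => (Dvd.intro_left 4 rfl).trans (h4 i)
  let G := Finset.univ.filter (fun a : (ZMod N)ˣ => ∀ i, jacobiSym (q i) (a : ZMod N).val = η i)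
  have hG : G.card * 2 ^ r = N.totient := card_fiber q hq hdist η hη N hN8
  have hcount : ∀ x : ℝ, (((Finset.range (⌊x⌋₊ + 1)).filter (fun p => p.Prime ∧ p ≠ 2 ∧ (∀ i, p ≠ q i) ∧
          ∀ i, jacobiSym (q i : ℤ) p = η i)).card : ℝ) = ∑ a ∈ G, piA (a : ZMod N) x := by
    intro x
    let emb : (ZMod N)ˣ ↪ ZMod N := ⟨Units.val, Units.val_injective⟩
    have hmaps : Set.MapsTo (fun p : ℕ => (p : ZMod N))
        (↑((Finset.range (⌊x⌋₊ + 1)).filter (fun p => p.Prime ∧ p ≠ 2 ∧ (∀ i, p ≠ q i) ∧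
          ∀ i, jacobiSym (q i : ℤ) p = η i))) (↑(G.map emb)) := by
      intro p hp
      simp only [Finset.coe_filter, Set.mem_setOf_eq] at hp
      obtain ⟨-, hpp, hp2, hpq, hpj⟩ := hp
      have hcop : Nat.Coprime p N := by
        rw [hN8]
        refine Nat.Coprime.mul_right ?_ (Nat.Coprime.prod_right fun i _ => ?_)
        · rw [show 8 = 2 ^ 3 from rfl]
          exact Nat.Coprime.pow_right 3 ((Nat.coprime_primes hpp Nat.prime_two).2 hp2)
        · exact (Nat.coprime_primes hpp (hq i)).2 (hpq i)
      simp only [Finset.coe_map, Set.mem_image, Finset.mem_coe]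
      refine ⟨ZMod.unitOfCoprime p hcop, ?_, ?_⟩
      · simp only [G, Finset.mem_filter, Finset.mem_univ, true_and]
        intro i
        rw [jac_unit (q i) N (h4 i) h2 _ p (hpp.odd_of_ne_two hp2) (by simp), hpj i]
      · simp [emb]
    rw [Finset.card_eq_sum_card_fiberwise hmaps, Finset.sum_map, Nat.cast_sum]
    refine Finset.sum_congr rfl fun a ha => ?_
    unfold piA
    congr 2
    ext p
    simp only [Finset.mem_filter, Finset.mem_range]
    change (_ ∧ (p : ZMod N) = (a : ZMod N)) ↔ _
    constructor
    · rintro ⟨⟨h1, h2, -⟩, h3⟩; exact ⟨h1, h2, h3⟩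
    · rintro ⟨h1, hpp, h3⟩
      have hcop : Nat.Coprime p N := by
        rw [← ZMod.isUnit_iff_coprime, h3]; exact a.isUnit
      have hp2 : p ≠ 2 := fun h =>
        (Nat.coprime_primes hpp Nat.prime_two).1 (Nat.Coprime.coprime_dvd_right h2 hcop) h
      refine ⟨⟨h1, hpp, hp2, fun i h => ?_, fun i => ?_⟩, h3⟩
      · exact (Nat.coprime_primes hpp (hq i)).1 (Nat.Coprime.coprime_dvd_right (hqN i) hcop) h
      · rw [← jac_unit (q i) N (h4 i) h2 a p (hpp.odd_of_ne_two hp2) h3]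
        exact (Finset.mem_filter.1 ha).2 i
  simp_rw [hcount, Finset.sum_div]
  have := tendsto_finsetSum G (fun a _ => piA_div_tendsto (a := (a : ZMod N)) a.isUnit)
  convert this using 2
  rw [Finset.sum_const, nsmul_eq_mul, ← hG]
  have hg : (G.card : ℝ) ≠ 0 := by
    intro h
    have h' : G.card = 0 := by exact_mod_cast h
    rw [h', zero_mul] at hG
    exact (Nat.totient_pos.2 (Nat.pos_of_ne_zero hN0)).ne hG
  push_cast
  field_simp
end WI

/-- Equidistribution of Legendre symbol vectors: for distinct primes `q_1,…,q_r` and signs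
`η_i ∈ {±1}`, the proportion among primes `p ≤ x` of those (odd, outside `{q_i}`) with
`(q_i/p) = η_i` for all `i` tends to `2^(-r)`; i.e. the count is `2^(-r) π(x) + o(π(x))`. -/
theorem stmt8 (r : ℕ) (q : Fin r → ℕ) (hq : ∀ i, (q i).Prime)
    (hdist : Function.Injective q) (η : Fin r → ℤ) (hη : ∀ i, η i = 1 ∨ η i = -1) :
    Filter.Tendsto (fun x : ℝ =>
      ((((Finset.range (⌊x⌋₊ + 1)).filter (fun p => p.Prime ∧ p ≠ 2 ∧ (∀ i, p ≠ q i) ∧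
          ∀ i, jacobiSym (q i : ℤ) p = η i)).card : ℝ) /
        (((Finset.range (⌊x⌋₊ + 1)).filter Nat.Prime).card : ℝ)))
      Filter.atTop (nhds (1 / 2 ^ r)) := by
  exact WI.main r q hq hdist η hη

end
end

section
/- Fix ε ∈ (0,1] and an integer m ≥ 1. Let q_1 < q_2 < ⋯ < q_{π(m)} be the primes ≤ m, and for an odd prime p > m let v_m(p) := ((q_1/p), …, (q_{π(m)}/p)) ∈ {±1}^{π(m)}. Let A_m := {σ ∈ {±1}^{π(m)} : there exists an odd prime p > m with v_m(p) = σ and f_ε(p) > m}. Then the limit lim_{x→∞} a_m(x) exists and equals |A_m| / 2^{π(m)}. -/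
open Finset Filter

noncomputable section

namespace PNTAux
open MeasureTheory Set Topology Complex

/-- Fejer kernel -/
def KF (x : ℝ) : ℝ := 2 * (1 - Real.cos x) / x ^ 2

/-- triangle function -/
def tri (u : ℝ) : ℝ := max 0 (1 - |u|)

lemma KF_nonneg (x : ℝ) : 0 ≤ KF x := by
  unfold KF
  have := Real.cos_le_one x
  apply div_nonneg <;> nlinarith [sq_nonneg x]

lemma KF_le (x : ℝ) : KF x ≤ 5 * (1 + x ^ 2)⁻¹ := by
  unfold KF
  rw [← div_eq_mul_inv]
  rcases eq_or_ne x 0 with rfl | hx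
  · simp
  have h1 := Real.one_sub_sq_div_two_le_cos (x := x)
  have h2 := Real.neg_one_le_cos x
  have h3 : 0 < x ^ 2 := by positivity
  rw [div_le_div_iff₀ h3 (by positivity)]
  nlinarith

lemma KF_meas : Measurable KF := by
  unfold KF
  fun_prop

lemma KF_integrable : Integrable KF := by
  refine (integrable_inv_one_add_sq.const_mul 5).mono' KF_meas.aestronglyMeasurable ?_
  refine Eventually.of_forall fun x => ?_
  rw [Real.norm_of_nonneg (KF_nonneg x)]
  exact KF_le x

lemma KF_even (x : ℝ) : KF (-x) = KF x := by simp [KF]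

lemma KF_pos {x : ℝ} (h0 : 0 < x) (h1 : x < 1) : 0 < KF x := by
  unfold KF
  have : Real.cos x < 1 := by
    rw [← Real.cos_zero]
    exact Real.cos_lt_cos_of_nonneg_of_le_pi le_rfl (by linarith [Real.pi_gt_three]) h0
  apply div_pos
  · linarith
  · positivity

lemma KF_int_pos : 0 < ∫ x, KF x := by
  rw [integral_pos_iff_support_of_nonneg KF_nonneg KF_integrable]
  have : Ioo (0:ℝ) 1 ⊆ Function.support KF := fun x hx => (KF_pos hx.1 hx.2).ne'
  exact lt_of_lt_of_le (by simp) (measure_mono this)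

lemma tri_cont : Continuous tri := by unfold tri; fun_prop

lemma tri_nonneg (u : ℝ) : 0 ≤ tri u := le_max_left _ _

lemma tri_le (u : ℝ) : tri u ≤ (Icc (-1:ℝ) 1).indicator (fun _ => (1:ℝ)) u := by
  unfold tri indicator
  split_ifs with h
  · have := abs_nonneg u
    simp
  · simp only [max_le_iff, le_refl, true_and, sub_nonpos]
    by_contra! h'
    rw [abs_lt] at h'
    exact h ⟨h'.1.le, h'.2.le⟩

lemma ind_integrable : Integrable ((Icc (-1:ℝ) 1).indicator (fun _ => (1:ℝ))) := by
  rw [integrable_indicator_iff measurableSet_Icc]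
  simp [integrableOn_const_iff]

lemma tri_integrable : Integrable tri := by
  refine ind_integrable.mono' tri_cont.aestronglyMeasurable ?_
  refine Eventually.of_forall fun x => ?_
  rw [Real.norm_of_nonneg (tri_nonneg x)]
  exact tri_le x

lemma tri_fourier {x : ℝ} (hx : x ≠ 0) :
    ∫ u : ℝ, (tri u : ℂ) * cexp (I * u * x) = (KF x : ℂ) := by
  have hsupp : ∫ u : ℝ, (tri u : ℂ) * cexp (I * u * x)
      = ∫ u in (-1:ℝ)..1, (tri u : ℂ) * cexp (I * u * x) := by
    rw [intervalIntegral.integral_of_le (by norm_num), ← integral_Icc_eq_integral_Ioc]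
    symm
    apply setIntegral_eq_integral_of_forall_compl_eq_zero
    intro u hu
    have h1 := tri_le u
    rw [indicator_of_notMem hu] at h1
    have : tri u = 0 := le_antisymm h1 (tri_nonneg u)
    simp [this]
  have hc : Continuous (fun u : ℝ => (tri u : ℂ) * cexp (I * u * x)) := by
    have := tri_cont
    fun_prop
  have hx' : (x : ℂ) ≠ 0 := by exact_mod_cast hx
  have hIx : I * (x : ℂ) ≠ 0 := mul_ne_zero I_ne_zero hx'
  have hE : ∀ u : ℝ, HasDerivAt (fun u : ℝ => cexp (I * u * x)) (cexp (I * u * x) * (I * x)) u := by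
    intro u
    have h1 : HasDerivAt (fun u : ℝ => I * (u:ℂ) * x) (I * 1 * x) u :=
      ((Complex.ofRealCLM.hasDerivAt (x := u)).const_mul I).mul_const _
    simpa using h1.cexp
  have hid : ∀ u : ℝ, HasDerivAt (fun u : ℝ => (u : ℂ)) 1 u := fun u =>
    Complex.ofRealCLM.hasDerivAt (x := u)
  rw [hsupp, ← intervalIntegral.integral_add_adjacent_intervals (b := 0)
    (hc.intervalIntegrable _ _) (hc.intervalIntegrable _ _)]
  have e1 : ∫ u in (-1:ℝ)..0, (tri u : ℂ) * cexp (I * u * x)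
      = ∫ u in (-1:ℝ)..0, (1 + (u:ℂ)) * cexp (I * u * x) := by
    apply intervalIntegral.integral_congr
    intro u hu
    rw [Set.uIcc_of_le (by norm_num)] at hu
    have : tri u = 1 + u := by
      unfold tri
      rw [abs_of_nonpos hu.2, max_eq_right] <;> linarith [hu.1]
    simp [this]
  have e2 : ∫ u in (0:ℝ)..1, (tri u : ℂ) * cexp (I * u * x)
      = ∫ u in (0:ℝ)..1, (1 - (u:ℂ)) * cexp (I * u * x) := by
    apply intervalIntegral.integral_congr
    intro u hu
    rw [Set.uIcc_of_le (by norm_num)] at hu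
    have : tri u = 1 - u := by
      unfold tri
      rw [abs_of_nonneg hu.1, max_eq_right] ; linarith [hu.2]
    simp [this]
  have f1 : ∫ u in (-1:ℝ)..0, (1 + (u:ℂ)) * cexp (I * u * x) = _ :=
    intervalIntegral.integral_eq_sub_of_hasDerivAt
      (f := fun u : ℝ => (1 + (u:ℂ)) * cexp (I * u * x) / (I * x) - cexp (I * u * x) / (I * x) ^ 2)
      (fun u _ => by
        have := ((((hid u).const_add 1).mul (hE u)).div_const (I * x)).sub
          ((hE u).div_const ((I * x)^2))
        refine this.congr_deriv ?_
        field_simp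
        ring)
      (Continuous.intervalIntegrable (by fun_prop) _ _)
  have f2 : ∫ u in (0:ℝ)..1, (1 - (u:ℂ)) * cexp (I * u * x) = _ :=
    intervalIntegral.integral_eq_sub_of_hasDerivAt
      (f := fun u : ℝ => (1 - (u:ℂ)) * cexp (I * u * x) / (I * x) + cexp (I * u * x) / (I * x) ^ 2)
      (fun u _ => by
        have := ((((hid u).const_sub 1).mul (hE u)).div_const (I * x)).add
          ((hE u).div_const ((I * x)^2))
        refine this.congr_deriv ?_
        field_simp
        ring)
      (Continuous.intervalIntegrable (by fun_prop) _ _)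
  rw [e1, e2, f1, f2]
  have hcos : (Real.cos x : ℂ) = (cexp (I * x) + cexp (-(I * x))) / 2 := by
    rw [Complex.ofReal_cos, Complex.cos]
    congr 3 <;> ring_nf
  unfold KF
  push_cast
  rw [← Complex.ofReal_cos, hcos]
  have hI2 : (I * (x:ℂ)) ^ 2 = - (x:ℂ)^2 := by rw [mul_pow, I_sq]; ring
  rw [hI2]
  have a1 : I * -1 * (x:ℂ) = -(I * x) := by ring
  simp only [a1, mul_one, mul_zero, zero_mul, Complex.exp_zero, sub_self, add_neg_cancel, zero_div]
  field_simp
  ring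

lemma key_eq (h : ℝ → ℂ) (hm : Measurable h) (M : ℝ) (hb : ∀ t, ‖h t‖ ≤ M)
    (H : ℂ → ℂ) (hL : ∀ z : ℂ, 0 < z.re → ∫ t in Ioi (0:ℝ), h t * cexp (-z * t) = H z)
    (l : ℝ) (hl : 0 < l) (δ : ℝ) (hδ : 0 < δ) (T : ℝ) :
    ∫ t in Ioi (0:ℝ), h t * cexp (-δ * t) * KF (l * (T - t)) =
      ∫ u : ℝ, (tri u : ℂ) * cexp (I * u * (l * T)) * H (δ + I * u * l) := by
  have e1 : ∫ t in Ioi (0:ℝ), h t * cexp (-δ * t) * KF (l * (T - t)) =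
      ∫ t in Ioi (0:ℝ), ∫ u : ℝ, (h t * cexp (-δ * t)) * ((tri u : ℂ) * cexp (I * u * (l * (T - t) : ℝ))) := by
    apply integral_congr_ae
    have : ∀ᵐ t : ℝ ∂(volume.restrict (Ioi (0:ℝ))), t ≠ T :=
      ae_restrict_of_ae (by simp [ae_iff])
    filter_upwards [this] with t ht
    have : l * (T - t) ≠ 0 := mul_ne_zero hl.ne' (sub_ne_zero.2 ht.symm)
    rw [integral_const_mul, tri_fourier this]
  have hexp : IntegrableOn (fun t : ℝ => Real.exp (-δ * t)) (Ioi 0) :=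
    exp_neg_integrableOn_Ioi 0 hδ
  have hi : Integrable (fun t : ℝ => h t * cexp (-δ * t)) (volume.restrict (Ioi 0)) := by
    refine (hexp.const_mul M).mono' (by fun_prop) ?_
    refine Eventually.of_forall fun t => ?_
    rw [norm_mul, Complex.norm_exp]
    gcongr
    · exact (norm_nonneg _).trans (hb t)
    · exact hb t
    · simp
  rw [e1, integral_integral_swap]
  · congr 1
    ext u
    rw [← hL _ (by simp [hδ]), ← integral_const_mul]
    congr 1
    ext t
    have : cexp (I * u * (l * (T - t) : ℝ)) = cexp (I * u * (l * T)) * cexp (-(I * u * l) * t) := by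
      rw [← Complex.exp_add]; congr 1; push_cast; ring
    rw [this]
    have : cexp (-(δ + I * u * l) * t) = cexp (-δ * t) * cexp (-(I * u * l) * t) := by
      rw [← Complex.exp_add]; congr 1; ring
    rw [this]
    ring
  · have h1 := hi.mul_prod (ν := volume) (tri_integrable.ofReal (𝕜 := ℂ))
    refine h1.mono ?_ ?_
    · have := tri_cont.measurable
      unfold Function.uncurry
      fun_prop
    · refine Eventually.of_forall fun p => ?_
      simp only [Function.uncurry, norm_mul]
      gcongr
      have : ‖cexp (I * p.2 * (l * (T - p.1) : ℝ))‖ = 1 := by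
        rw [Complex.norm_exp]; simp
      rw [this, mul_one]
      exact le_rfl

lemma key_eq0 (h : ℝ → ℂ) (hm : Measurable h) (M : ℝ) (hb : ∀ t, ‖h t‖ ≤ M)
    (H : ℂ → ℂ) (hH : ContinuousOn H {z | 0 ≤ z.re})
    (hL : ∀ z : ℂ, 0 < z.re → ∫ t in Ioi (0:ℝ), h t * cexp (-z * t) = H z)
    (l : ℝ) (hl : 0 < l) (T : ℝ) :
    ∫ t in Ioi (0:ℝ), h t * KF (l * (T - t)) =
      ∫ u : ℝ, (tri u : ℂ) * cexp (I * u * (l * T)) * H (I * u * l) := by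
  have hM : 0 ≤ M := (norm_nonneg _).trans (hb 0)
  have hKi : Integrable (fun t => KF (l * (T - t))) := by
    have := (KF_integrable.comp_mul_left' hl.ne').comp_sub_left T
    exact this
  have t1 : Tendsto (fun δ : ℝ => ∫ t in Ioi (0:ℝ), h t * cexp (-δ * t) * KF (l * (T - t)))
      (𝓝[>] 0) (𝓝 (∫ t in Ioi (0:ℝ), h t * KF (l * (T - t)))) := by
    apply tendsto_integral_filter_of_dominated_convergence (fun t => M * KF (l * (T - t)))
    · refine Eventually.of_forall fun δ => ?_
      have := KF_meas
      fun_prop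
    · filter_upwards [self_mem_nhdsWithin] with δ hδ
      filter_upwards [ae_restrict_mem measurableSet_Ioi] with t ht
      rw [norm_mul, norm_mul, Complex.norm_exp, Complex.norm_real, Real.norm_of_nonneg (KF_nonneg _)]
      gcongr
      · exact KF_nonneg _
      · have : Real.exp ((-(δ:ℂ) * t).re) ≤ 1 := by
          rw [Real.exp_le_one_iff]
          simp only [Set.mem_Ioi] at hδ ht
          simp; positivity
        calc _ ≤ ‖h t‖ * 1 := by gcongr
          _ ≤ M := by simpa using hb t
    · exact (hKi.const_mul M).restrict
    · refine Eventually.of_forall fun t => ?_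
      have : Continuous (fun δ : ℝ => h t * cexp (-δ * t) * KF (l * (T - t))) := by fun_prop
      have := this.tendsto 0
      simp only [ofReal_zero, neg_zero, zero_mul, Complex.exp_zero, mul_one] at this
      exact this.mono_left nhdsWithin_le_nhds
  have hK : IsCompact ((fun p : ℝ × ℝ => (p.1 : ℂ) + I * p.2 * l) '' (Set.Icc 0 1 ×ˢ Set.Icc (-1) 1)) := by
    apply (isCompact_Icc.prod isCompact_Icc).image
    fun_prop
  obtain ⟨B, hB⟩ := hK.exists_bound_of_continuousOn (hH.mono (by
    rintro _ ⟨p, hp, rfl⟩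
    simpa using hp.1.1))
  have hmap : ∀ δ : ℝ, 0 ≤ δ → Continuous (fun u : ℝ => H (δ + I * u * l)) := by
    intro δ hδ
    apply hH.comp_continuous (by fun_prop)
    intro u
    simpa using hδ
  have t2 : Tendsto (fun δ : ℝ => ∫ u : ℝ, (tri u : ℂ) * cexp (I * u * (l * T)) * H (δ + I * u * l))
      (𝓝[>] 0) (𝓝 (∫ u : ℝ, (tri u : ℂ) * cexp (I * u * (l * T)) * H (I * u * l))) := by
    apply tendsto_integral_filter_of_dominated_convergence
      (fun u => B * (Icc (-1:ℝ) 1).indicator (fun _ => (1:ℝ)) u)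
    · filter_upwards [self_mem_nhdsWithin] with δ hδ
      have h1 := hmap δ (le_of_lt hδ)
      have := tri_cont
      exact Continuous.aestronglyMeasurable (Continuous.mul (by fun_prop) h1)
    · filter_upwards [Ioc_mem_nhdsGT (zero_lt_one (α := ℝ))] with δ hδ
      refine Eventually.of_forall fun u => ?_
      have h1 : ‖cexp (I * u * (l * T))‖ = 1 := by
        rw [Complex.norm_exp]; simp
      rw [norm_mul, norm_mul, h1, mul_one, Complex.norm_real, Real.norm_of_nonneg (tri_nonneg _),
        mul_comm]
      by_cases hu : u ∈ Icc (-1:ℝ) 1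
      · have h2 := tri_le u
        gcongr
        · exact tri_nonneg _
        · exact (norm_nonneg _).trans (hB _ ⟨(δ, u), ⟨⟨hδ.1.le, hδ.2⟩, hu⟩, rfl⟩)
        · exact hB _ ⟨(δ, u), ⟨⟨hδ.1.le, hδ.2⟩, hu⟩, rfl⟩
      · have h2 := tri_le u
        rw [indicator_of_notMem hu] at h2 ⊢
        rw [le_antisymm h2 (tri_nonneg u)]
        simp
    · exact ind_integrable.const_mul B
    · refine Eventually.of_forall fun u => ?_
      apply Tendsto.const_mul
      have hc : ContinuousWithinAt H {z | 0 ≤ z.re} (I * u * l) := hH _ (by simp)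
      apply hc.tendsto.comp
      apply tendsto_nhdsWithin_iff.2 ⟨?_, ?_⟩
      · have : Continuous (fun δ : ℝ => (δ : ℂ) + I * u * l) := by fun_prop
        have := this.tendsto 0
        simp only [ofReal_zero, zero_add] at this
        exact this.mono_left nhdsWithin_le_nhds
      · filter_upwards [self_mem_nhdsWithin] with δ hδ
        simpa using (le_of_lt hδ)
  refine tendsto_nhds_unique t1 (t2.congr' ?_)
  filter_upwards [self_mem_nhdsWithin] with δ hδ
  exact (key_eq h hm M hb H hL l hl δ hδ T).symm

lemma key (h : ℝ → ℂ) (hm : Measurable h) (M : ℝ) (hb : ∀ t, ‖h t‖ ≤ M)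
    (H : ℂ → ℂ) (hH : ContinuousOn H {z | 0 ≤ z.re})
    (hL : ∀ z : ℂ, 0 < z.re → ∫ t in Ioi (0:ℝ), h t * cexp (-z * t) = H z)
    (l : ℝ) (hl : 0 < l) :
    Tendsto (fun T : ℝ => ∫ t in Ioi (0:ℝ), h t * KF (l * (T - t))) atTop (𝓝 0) := by
  simp_rw [key_eq0 h hm M hb H hH hL l hl]
  have rl := Real.tendsto_integral_exp_smul_cocompact (fun u : ℝ => (tri u : ℂ) * H (I * u * l))
  have hw : Tendsto (fun T : ℝ => -(l * T / (2 * Real.pi))) atTop (cocompact ℝ) := by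
    rw [cocompact_eq_atBot_atTop]
    refine Tendsto.mono_right ?_ le_sup_left
    apply tendsto_neg_atTop_atBot.comp
    apply Tendsto.atTop_div_const (by positivity)
    exact tendsto_id.const_mul_atTop hl
  refine (rl.comp hw).congr fun T => ?_
  simp only [Function.comp]
  congr 1
  ext u
  rw [Circle.smul_def, Real.fourierChar_apply, smul_eq_mul]
  have : (↑(2 * Real.pi * -(u * -(l * T / (2 * Real.pi)))) * I : ℂ) = I * u * (l * T) := by
    have : (Real.pi : ℂ) ≠ 0 := by exact_mod_cast Real.pi_ne_zero
    push_cast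
    field_simp
  rw [this]
  ring

end PNTAux
namespace PNTAux
open MeasureTheory Set Topology

lemma KF_comp_int {l : ℝ} (hl : 0 < l) (T : ℝ) : Integrable (fun t => KF (l * (T - t))) :=
  (KF_integrable.comp_mul_left' hl.ne').comp_sub_left T

lemma half_tendsto {l : ℝ} (hl : 0 < l) :
    Tendsto (fun T : ℝ => ∫ t in Set.Ioi (0:ℝ), KF (l * (T - t))) atTop
      (𝓝 (l⁻¹ * ∫ x, KF x)) := by
  have e : ∀ T : ℝ, ∫ t in Set.Ioi (0:ℝ), KF (l * (T - t)) = ∫ s in Set.Iio T, KF (l * s) := by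
    intro T
    rw [← integral_indicator measurableSet_Ioi, ← integral_indicator measurableSet_Iio,
      ← integral_sub_left_eq_self _ volume T]
    congr 1
    ext t
    simp [Set.indicator]
  simp_rw [e]
  have := (aecover_Iio (μ := volume) (tendsto_id (α := ℝ) (x := atTop))).integral_tendsto_of_countably_generated
    (KF_integrable.comp_mul_left' hl.ne')
  rw [Measure.integral_comp_mul_left] at this
  simpa [abs_of_pos hl] using this

lemma win_int {l : ℝ} (hl : 0 < l) (R : ℝ) (hR : 0 < R) (T : ℝ) :
    ∫ t in Set.Icc (T - R / l) (T + R / l), KF (l * (T - t)) = l⁻¹ * ∫ x in (-R)..R, KF x := by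
  have : T - R / l ≤ T + R / l := by have : 0 < R / l := by positivity
                                     linarith
  rw [integral_Icc_eq_integral_Ioc, ← intervalIntegral.integral_of_le this]
  have h := intervalIntegral.integral_comp_sub_mul (a := T - R / l) (b := T + R / l) KF hl.ne' (l * T)
  rw [smul_eq_mul] at h
  have e : ∀ t, l * T - l * t = l * (T - t) := fun t => by ring
  simp_rw [e] at h
  rw [h]
  congr 2 <;> field_simp <;> ring

lemma taub_real (F : ℝ → ℝ) (hm : Measurable F) (C : ℝ) (h0 : ∀ t, 0 ≤ F t) (hC : ∀ t, F t ≤ C)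
    (hneg : ∀ t < 0, F t = 0) (hmono : ∀ s t, s ≤ t → F s * Real.exp s ≤ F t * Real.exp t)
    (c : ℝ) (hΦ : ∀ l : ℝ, 0 < l →
      Tendsto (fun T => ∫ t in Set.Ioi (0:ℝ), (F t - c) * KF (l * (T - t))) atTop (𝓝 0)) :
    Tendsto F atTop (𝓝 c) := by
  set J := ∫ x, KF x with hJ
  have hJ0 : 0 < J := KF_int_pos
  have hCn : 0 ≤ C := (h0 0).trans (hC 0)
  have hFi : ∀ l : ℝ, 0 < l → ∀ T, Integrable (fun t => F t * KF (l * (T - t))) := by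
    intro l hl T
    refine ((KF_comp_int hl T).const_mul C).mono' ?_ ?_
    · have := KF_meas
      fun_prop
    · refine Eventually.of_forall fun t => ?_
      rw [Real.norm_of_nonneg (mul_nonneg (h0 t) (KF_nonneg _))]
      exact mul_le_mul_of_nonneg_right (hC t) (KF_nonneg _)
  have stepA : ∀ l : ℝ, 0 < l →
      Tendsto (fun T => l * ∫ t, F t * KF (l * (T - t))) atTop (𝓝 (c * J)) := by
    intro l hl
    have h1 := ((hΦ l hl).add ((half_tendsto hl).const_mul c)).const_mul l
    have e : l * (0 + c * (l⁻¹ * J)) = c * J := by field_simp; ring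
    rw [e] at h1
    refine h1.congr fun T => ?_
    congr 1
    rw [← integral_const_mul, ← integral_add]
    · have : ∀ t, (F t - c) * KF (l * (T - t)) + c * KF (l * (T - t)) = F t * KF (l * (T - t)) :=
        fun t => by ring
      simp_rw [this]
      rw [← integral_Ici_eq_integral_Ioi]
      apply setIntegral_eq_integral_of_forall_compl_eq_zero
      intro t ht
      rw [hneg t (by simpa using ht), zero_mul]
    · simp_rw [sub_mul]
      exact ((hFi l hl T).sub ((KF_comp_int hl T).const_mul c)).restrict
    · exact ((KF_comp_int hl T).const_mul c).restrict
  have low : ∀ R l T : ℝ, 0 < R → 0 < l →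
      F (T - R / l) * Real.exp (-(2 * (R / l))) * ∫ x in (-R)..R, KF x
        ≤ l * ∫ t, F t * KF (l * (T - t)) := by
    intro R l T hR hl
    have a1 : ∫ t in Set.Icc (T - R / l) (T + R / l), F t * KF (l * (T - t)) ≤
        ∫ t, F t * KF (l * (T - t)) :=
      setIntegral_le_integral (hFi l hl T)
        (Eventually.of_forall fun t => mul_nonneg (h0 t) (KF_nonneg _))
    have a2 : ∫ t in Set.Icc (T - R / l) (T + R / l),
          F (T - R / l) * Real.exp (-(2 * (R / l))) * KF (l * (T - t)) ≤
        ∫ t in Set.Icc (T - R / l) (T + R / l), F t * KF (l * (T - t)) := by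
      apply setIntegral_mono_on ((KF_comp_int hl T).const_mul _).integrableOn
        (hFi l hl T).integrableOn measurableSet_Icc
      intro t ht
      apply mul_le_mul_of_nonneg_right _ (KF_nonneg _)
      have m := hmono _ _ ht.1
      have : Real.exp (-(2 * (R / l))) ≤ Real.exp (T - R / l - t) :=
        Real.exp_le_exp.2 (by linarith [ht.2])
      calc F (T - R / l) * Real.exp (-(2 * (R / l)))
          ≤ F (T - R / l) * Real.exp (T - R / l - t) := mul_le_mul_of_nonneg_left this (h0 _)
        _ = F (T - R / l) * Real.exp (T - R / l) * Real.exp (-t) := by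
            rw [mul_assoc, ← Real.exp_add]; rfl
        _ ≤ F t * Real.exp t * Real.exp (-t) := by gcongr
        _ = F t := by rw [mul_assoc, ← Real.exp_add]; simp
    rw [integral_const_mul, win_int hl R hR] at a2
    calc _ = l * (F (T - R / l) * Real.exp (-(2 * (R / l))) * (l⁻¹ * ∫ x in (-R)..R, KF x)) := by
            field_simp
      _ ≤ _ := by gcongr; exact a2.trans a1
  have upp : ∀ R l T : ℝ, 0 < R → 0 < l →
      l * ∫ t, F t * KF (l * (T - t)) ≤
      F (T + R / l) * Real.exp (2 * (R / l)) * (∫ x in (-R)..R, KF x)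
        + C * (J - ∫ x in (-R)..R, KF x) := by
    intro R l T hR hl
    have tot : ∫ t, KF (l * (T - t)) = l⁻¹ * J := by
      rw [integral_sub_left_eq_self (fun t => KF (l * t)) volume T, Measure.integral_comp_mul_left]
      simp [abs_of_pos hl, hJ]
    have s1 := integral_add_compl (measurableSet_Icc (a := T - R / l) (b := T + R / l)) (hFi l hl T)
    have s2 := integral_add_compl (measurableSet_Icc (a := T - R / l) (b := T + R / l))
      (KF_comp_int hl T)
    rw [win_int hl R hR, tot] at s2
    have a1 : ∫ t in (Set.Icc (T - R / l) (T + R / l))ᶜ, F t * KF (l * (T - t)) ≤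
        ∫ t in (Set.Icc (T - R / l) (T + R / l))ᶜ, C * KF (l * (T - t)) := by
      apply setIntegral_mono (hFi l hl T).integrableOn ((KF_comp_int hl T).const_mul _).integrableOn
      intro t
      exact mul_le_mul_of_nonneg_right (hC t) (KF_nonneg _)
    have a2 : ∫ t in Set.Icc (T - R / l) (T + R / l), F t * KF (l * (T - t)) ≤
        ∫ t in Set.Icc (T - R / l) (T + R / l),
          F (T + R / l) * Real.exp (2 * (R / l)) * KF (l * (T - t)) := by
      apply setIntegral_mono_on (hFi l hl T).integrableOn
        ((KF_comp_int hl T).const_mul _).integrableOn measurableSet_Icc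
      intro t ht
      apply mul_le_mul_of_nonneg_right _ (KF_nonneg _)
      have m := hmono _ _ ht.2
      have : Real.exp (T + R / l - t) ≤ Real.exp (2 * (R / l)) :=
        Real.exp_le_exp.2 (by linarith [ht.1])
      calc F t = F t * Real.exp t * Real.exp (-t) := by rw [mul_assoc, ← Real.exp_add]; simp
        _ ≤ F (T + R / l) * Real.exp (T + R / l) * Real.exp (-t) := by gcongr
        _ = F (T + R / l) * Real.exp (T + R / l - t) := by
            rw [mul_assoc, ← Real.exp_add]; rfl
        _ ≤ _ := mul_le_mul_of_nonneg_left this (h0 _)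
    rw [integral_const_mul, win_int hl R hR] at a2
    rw [integral_const_mul] at a1
    rw [← s1]
    have s3 : ∫ t in (Set.Icc (T - R / l) (T + R / l))ᶜ, KF (l * (T - t))
      = l⁻¹ * (J - ∫ x in (-R)..R, KF x) := by linarith
    rw [s3] at a1
    calc _ ≤ l * (F (T + R / l) * Real.exp (2 * (R / l)) * (l⁻¹ * ∫ x in (-R)..R, KF x) +
          C * (l⁻¹ * (J - ∫ x in (-R)..R, KF x))) := by gcongr
      _ = _ := by field_simp
  have hIR : Tendsto (fun R : ℝ => ∫ x in (-R)..R, KF x) atTop (𝓝 J) :=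
    intervalIntegral_tendsto_integral KF_integrable tendsto_neg_atTop_atBot tendsto_id
  have hinv : Tendsto (fun R : ℝ => R⁻¹) atTop (𝓝 0) := tendsto_inv_atTop_zero
  have hU : Tendsto (fun R : ℝ => Real.exp (2 * R⁻¹) * (c * J + R⁻¹) / ∫ x in (-R)..R, KF x)
      atTop (𝓝 c) := by
    have h1 : Tendsto (fun R : ℝ => Real.exp (2 * R⁻¹)) atTop (𝓝 (Real.exp (2 * 0))) :=
      (Real.continuous_exp.tendsto _).comp (hinv.const_mul 2)
    have := (h1.mul (hinv.const_add (c * J))).div hIR hJ0.ne'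
    simp only [mul_zero, Real.exp_zero, add_zero, one_mul, mul_div_cancel_right₀ _ hJ0.ne'] at this
    exact this
  have hLo : Tendsto (fun R : ℝ => Real.exp (-(2 * R⁻¹)) *
      (c * J - R⁻¹ - C * (J - ∫ x in (-R)..R, KF x)) / ∫ x in (-R)..R, KF x)
      atTop (𝓝 c) := by
    have h1 : Tendsto (fun R : ℝ => Real.exp (-(2 * R⁻¹))) atTop (𝓝 (Real.exp (-(2 * 0)))) :=
      (Real.continuous_exp.tendsto _).comp (hinv.const_mul 2).neg
    have := (h1.mul ((hinv.const_sub (c * J)).sub ((hIR.const_sub J).const_mul C))).div hIR hJ0.ne'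
    simp only [mul_zero, neg_zero, Real.exp_zero, sub_zero, sub_self, one_mul, mul_div_cancel_right₀ _ hJ0.ne'] at this
    exact this
  rw [tendsto_order]
  constructor
  · intro a ha
    obtain ⟨R, hR1, hR2, hR3⟩ := ((hLo.eventually (lt_mem_nhds ha)).and
      ((eventually_gt_atTop 0).and (hIR.eventually (lt_mem_nhds hJ0)))).exists
    have hl : 0 < R ^ 2 := by positivity
    have hRl : R / R ^ 2 = R⁻¹ := by field_simp
    have hev := (stepA (R ^ 2) hl).eventually
      (lt_mem_nhds (show c * J - R⁻¹ < c * J by have := inv_pos.2 hR2; linarith))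
    have hsh : Tendsto (fun T : ℝ => T - R⁻¹) atTop atTop := tendsto_atTop_add_const_right _ _ tendsto_id
    filter_upwards [hsh.eventually hev] with T hT
    have u := upp R (R ^ 2) (T - R⁻¹) hR2 hl
    rw [hRl, sub_add_cancel] at u
    refine hR1.trans_le ?_
    rw [div_le_iff₀ hR3, Real.exp_neg, ← div_eq_inv_mul, div_le_iff₀ (Real.exp_pos _)]
    nlinarith
  · intro a ha
    obtain ⟨R, hR1, hR2, hR3⟩ := ((hU.eventually (gt_mem_nhds ha)).and
      ((eventually_gt_atTop 0).and (hIR.eventually (lt_mem_nhds hJ0)))).exists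
    have hl : 0 < R ^ 2 := by positivity
    have hRl : R / R ^ 2 = R⁻¹ := by field_simp
    have hev := (stepA (R ^ 2) hl).eventually
      (gt_mem_nhds (show c * J < c * J + R⁻¹ by have := inv_pos.2 hR2; linarith))
    have hsh : Tendsto (fun T : ℝ => T + R⁻¹) atTop atTop := tendsto_atTop_add_const_right _ _ tendsto_id
    filter_upwards [hsh.eventually hev] with T hT
    have u := low R (R ^ 2) (T + R⁻¹) hR2 hl
    rw [hRl, add_sub_cancel_right] at u
    refine lt_of_le_of_lt ?_ hR1
    rw [le_div_iff₀ hR3]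
    have : F T * (∫ x in (-R)..R, KF x) =
      Real.exp (2 * R⁻¹) * (F T * Real.exp (-(2 * R⁻¹)) * ∫ x in (-R)..R, KF x) := by
      have : Real.exp (2 * R⁻¹) * Real.exp (-(2 * R⁻¹)) = 1 := by rw [← Real.exp_add]; simp
      linear_combination (-(F T * ∫ x in (-R)..R, KF x)) * this
    rw [this]
    gcongr
    exact u.trans hT.le

end PNTAux
namespace PNTAux
open MeasureTheory Set Topology Complex

theorem taub (a : ℕ → ℝ) (ha : ∀ n, 0 ≤ a n) (C : ℝ)
    (hC : ∀ x : ℝ, 0 ≤ x → ∑ n ∈ Finset.Icc 1 ⌊x⌋₊, a n ≤ C * x) (c : ℝ) (G : ℂ → ℂ)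
    (hG : ContinuousOn G {s | 1 ≤ s.re})
    (hL : ∀ s : ℂ, 1 < s.re → LSeries (fun n => (a n : ℂ)) s = c / (s - 1) + G s) :
    Tendsto (fun x : ℝ => (∑ n ∈ Finset.Icc 1 ⌊x⌋₊, a n) / x) atTop (𝓝 c) := by
  set A : ℝ → ℝ := fun x => ∑ n ∈ Finset.Icc 1 ⌊x⌋₊, a n with hA
  have hAmono : Monotone A := by
    intro x y hxy
    apply Finset.sum_le_sum_of_subset_of_nonneg
    · exact Finset.Icc_subset_Icc_right (Nat.floor_mono hxy)
    · intros; exact ha _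
  have hA0 : ∀ x, 0 ≤ A x := fun x => Finset.sum_nonneg fun _ _ => ha _
  set F : ℝ → ℝ := fun t => A (Real.exp t) * Real.exp (-t) with hF
  have hFm : Measurable F := by
    have := hAmono.measurable
    fun_prop
  have hF0 : ∀ t, 0 ≤ F t := fun t => mul_nonneg (hA0 _) (Real.exp_pos _).le
  have hFC : ∀ t, F t ≤ C := by
    intro t
    calc F t ≤ C * Real.exp t * Real.exp (-t) := by
          simp only [hF]
          gcongr
          exact hC _ (Real.exp_pos _).le
      _ = C := by rw [mul_assoc, ← Real.exp_add]; simp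
  have hFneg : ∀ t < 0, F t = 0 := by
    intro t ht
    have : ⌊Real.exp t⌋₊ = 0 := Nat.floor_eq_zero.2 (by simpa using ht)
    simp [hF, hA, this]
  have hFe : ∀ t, F t * Real.exp t = A (Real.exp t) := by
    intro t
    simp only [hF]
    rw [mul_assoc, ← Real.exp_add]; simp
  have hbd : ∀ t, ‖((F t - c : ℝ) : ℂ)‖ ≤ C + |c| := by
    intro t
    rw [Complex.norm_real, Real.norm_eq_abs]
    refine (abs_sub _ _).trans ?_
    rw [abs_of_nonneg (hF0 t)]
    gcongr
    exact hFC t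
  have hne : ∀ z : ℂ, 0 ≤ z.re → 1 + z ≠ 0 := by
    intro z hz h
    have := congrArg Complex.re h
    simp at this
    linarith
  have hO : (fun n : ℕ ↦ ∑ k ∈ Finset.Icc 1 n, a k) =O[atTop] fun n ↦ (n : ℝ) ^ (1:ℝ) := by
    apply Asymptotics.IsBigO.of_bound C
    refine Eventually.of_forall fun n => ?_
    rw [Real.norm_of_nonneg (Finset.sum_nonneg fun _ _ => ha _), Real.rpow_one,
      Real.norm_of_nonneg (Nat.cast_nonneg n)]
    simpa using hC n (Nat.cast_nonneg n)
  have hexp : ∀ z : ℂ, 0 < z.re → IntegrableOn (fun t : ℝ => cexp (-z * t)) (Set.Ioi 0) := by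
    intro z hz
    exact integrableOn_exp_mul_complex_Ioi (by simpa using hz) 0
  have hlap : ∀ z : ℂ, 0 < z.re →
      ∫ t in Set.Ioi (0:ℝ), ((F t - c : ℝ) : ℂ) * cexp (-z * t) = (G (1 + z) - c) / (1 + z) := by
    intro z hz
    have hz0 : z ≠ 0 := by rintro rfl; simp at hz
    have hz1 := hne z hz.le
    have h1 := LSeries_eq_mul_integral_of_nonneg a zero_le_one (s := 1 + z) (by simpa using hz) hO ha
    rw [hL _ (by simpa using hz)] at h1
    have h2 := integral_comp_exp_Ioi
      (fun x : ℝ => (∑ k ∈ Finset.Icc 1 ⌊x⌋₊, (a k : ℂ)) * (x : ℂ) ^ (-((1 + z) + 1))) 0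
    rw [Real.exp_zero] at h2
    rw [← h2] at h1
    have h3 : ∀ t : ℝ, Real.exp t • ((∑ k ∈ Finset.Icc 1 ⌊Real.exp t⌋₊, (a k : ℂ)) *
        ((Real.exp t : ℝ) : ℂ) ^ (-((1 + z) + 1))) = (F t : ℂ) * cexp (-z * t) := by
      intro t
      simp only [hF, hA]
      rw [Complex.real_smul, Complex.cpow_def_of_ne_zero (by exact_mod_cast (Real.exp_pos t).ne'),
        ← Complex.ofReal_log (Real.exp_pos t).le, Real.log_exp]
      push_cast
      rw [mul_left_comm, ← Complex.exp_add, mul_assoc, ← Complex.exp_add]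
      congr 2
      ring
    simp_rw [h3] at h1
    have hi1 : IntegrableOn (fun t : ℝ => (F t : ℂ) * cexp (-z * t)) (Set.Ioi 0) := by
      refine Integrable.bdd_mul (c := C) (hexp z hz) (by fun_prop) ?_
      refine Eventually.of_forall fun t => ?_
      rw [Complex.norm_real, Real.norm_of_nonneg (hF0 t)]
      exact hFC t
    have h4 : ∫ t in Set.Ioi (0:ℝ), ((F t - c : ℝ) : ℂ) * cexp (-z * t)
        = (∫ t in Set.Ioi (0:ℝ), (F t : ℂ) * cexp (-z * t)) - c * ∫ t in Set.Ioi (0:ℝ), cexp (-z * t) := by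
      rw [← integral_const_mul, ← integral_sub hi1 ((hexp z hz).const_mul _)]
      congr 1
      ext t
      push_cast
      ring
    have h5 : ∫ t in Set.Ioi (0:ℝ), cexp (-z * t) = 1 / z := by
      rw [integral_exp_mul_complex_Ioi (by simpa using hz)]
      simp
    rw [h4, h5]
    rw [add_sub_cancel_left] at h1
    have h6 : (∫ t in Set.Ioi (0:ℝ), (F t : ℂ) * cexp (-z * t)) = (c / z + G (1 + z)) / (1 + z) := by
      rw [h1]; field_simp
    rw [h6]
    field_simp
    ring
  have hcont : ContinuousOn (fun z : ℂ => (G (1 + z) - c) / (1 + z)) {z | 0 ≤ z.re} := by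
    apply ContinuousOn.div
    · apply ContinuousOn.sub _ continuousOn_const
      apply hG.comp (by fun_prop)
      intro z hz
      simpa using hz
    · fun_prop
    · intro z hz
      exact hne z hz
  have hlim : Tendsto F atTop (𝓝 c) := by
    apply taub_real F hFm C hF0 hFC hFneg
    · intro s t hst
      rw [hFe, hFe]
      exact hAmono (Real.exp_le_exp.2 hst)
    · intro l hl
      have k := key (fun t => ((F t - c : ℝ) : ℂ)) (by fun_prop) _ hbd _ hcont hlap l hl
      have k2 := (Complex.continuous_re.tendsto _).comp k
      rw [Complex.zero_re] at k2
      refine k2.congr fun T => ?_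
      simp only [Function.comp, ← Complex.ofReal_mul]
      rw [integral_complex_ofReal, Complex.ofReal_re]
  refine (hlim.comp Real.tendsto_log_atTop).congr' ?_
  filter_upwards [eventually_gt_atTop 0] with x hx
  simp [hF, hA, Real.exp_log hx, Real.exp_neg, div_eq_mul_inv]

/-- weighted count in residue classes -/
theorem psi_ap (N : ℕ) [NeZero N] (b : ZMod N) (hb : IsUnit b) :
    Tendsto (fun x : ℝ => (∑ n ∈ Finset.Icc 1 ⌊x⌋₊,
      ArithmeticFunction.vonMangoldt.residueClass b n) / x) atTop (𝓝 ((N.totient : ℝ)⁻¹)) := by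
  apply taub _ (ArithmeticFunction.vonMangoldt.residueClass_nonneg b) (Real.log 4 + 4) _ _
    (ArithmeticFunction.vonMangoldt.LFunctionResidueClassAux b)
    (ArithmeticFunction.vonMangoldt.continuousOn_LFunctionResidueClassAux b)
  · intro s hs
    have := ArithmeticFunction.vonMangoldt.eqOn_LFunctionResidueClassAux hb hs
    rw [this]
    push_cast
    ring
  · intro x hx
    refine le_trans ?_ (Chebyshev.psi_le_const_mul_self hx)
    exact Finset.sum_le_sum fun n _ => ArithmeticFunction.vonMangoldt.residueClass_le b n

end PNTAux
namespace PNTAux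
open Topology
open scoped Classical

/-- primes satisfying a condition, up to x -/
def PQ (Q : ℕ → Prop) (x : ℝ) : Finset ℕ := (Finset.Icc 1 ⌊x⌋₊).filter (fun p => p.Prime ∧ Q p)

theorem theta_ap (N : ℕ) [NeZero N] (b : ZMod N) (hb : IsUnit b) :
    Tendsto (fun x : ℝ => (∑ p ∈ PQ (fun p => (p : ZMod N) = b) x, Real.log p) / x) atTop
      (𝓝 ((N.totient : ℝ)⁻¹)) := by
  obtain ⟨C, hC⟩ := Chebyshev.psi_sub_theta_le_mul_sqrt
  have h1 := psi_ap N b hb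
  have h2 : Tendsto (fun x : ℝ => (∑ n ∈ (Finset.Icc 1 ⌊x⌋₊).filter (fun n => ¬ n.Prime),
      ArithmeticFunction.vonMangoldt.residueClass b n) / x) atTop (𝓝 0) := by
    have h3 : Tendsto (fun x : ℝ => C * (√x)⁻¹) atTop (𝓝 (C * 0)) :=
      (tendsto_inv_atTop_zero.comp Real.tendsto_sqrt_atTop).const_mul C
    rw [mul_zero] at h3
    refine tendsto_of_tendsto_of_tendsto_of_le_of_le' tendsto_const_nhds h3 ?_ ?_
    · filter_upwards [eventually_gt_atTop 0] with x hx
      apply div_nonneg _ hx.le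
      exact Finset.sum_nonneg fun n _ => ArithmeticFunction.vonMangoldt.residueClass_nonneg b n
    · filter_upwards [eventually_gt_atTop 0] with x hx
      rw [div_le_iff₀ hx]
      have e : C * (√x)⁻¹ * x = C * √x := by
        have := Real.sqrt_pos.2 hx
        field_simp
        rw [Real.sq_sqrt hx.le]
      rw [e]
      refine le_trans ?_ (hC x)
      rw [Chebyshev.psi_sub_theta_eq_sum_not_prime]
      exact Finset.sum_le_sum fun n _ => ArithmeticFunction.vonMangoldt.residueClass_le b n
  have h4 := h1.sub h2
  rw [sub_zero] at h4
  refine h4.congr fun x => ?_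
  rw [← sub_div]
  congr 1
  rw [← Finset.sum_filter_add_sum_filter_not (Finset.Icc 1 ⌊x⌋₊) (fun n => n.Prime)
    (fun n => ArithmeticFunction.vonMangoldt.residueClass b n), add_sub_cancel_right]
  unfold PQ
  rw [← Finset.filter_filter, Finset.sum_filter (s := (Finset.Icc 1 ⌊x⌋₊).filter _)]
  apply Finset.sum_congr rfl
  intro n hn
  have hp := (Finset.mem_filter.1 hn).2
  simp only [ArithmeticFunction.vonMangoldt.residueClass, Set.indicator, Set.mem_ofPred_eq,
    ArithmeticFunction.vonMangoldt_apply_prime hp]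
  split_ifs <;> rfl

theorem pi_of_theta (Q : ℕ → Prop) (c : ℝ)
    (h : Tendsto (fun x : ℝ => (∑ p ∈ PQ Q x, Real.log p) / x) atTop (𝓝 c)) :
    Tendsto (fun x : ℝ => ((PQ Q x).card : ℝ) * Real.log x / x) atTop (𝓝 c) := by
  have hmem : ∀ x : ℝ, 1 ≤ x → ∀ p ∈ PQ Q x, (1:ℝ) ≤ p ∧ (p:ℝ) ≤ x := by
    intro x hx p hp
    have := Finset.mem_Icc.1 (Finset.mem_filter.1 hp).1
    exact ⟨by exact_mod_cast this.1, (Nat.le_floor_iff (by linarith)).1 this.2⟩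
  have lo : ∀ x : ℝ, 1 ≤ x → ∑ p ∈ PQ Q x, Real.log p ≤ ((PQ Q x).card : ℝ) * Real.log x := by
    intro x hx
    rw [← nsmul_eq_mul]
    apply Finset.sum_le_card_nsmul
    intro p hp
    obtain ⟨h1, h2⟩ := hmem x hx p hp
    exact Real.log_le_log (by linarith) h2
  have up : ∀ η : ℝ, 0 < η → ∀ x : ℝ, 1 ≤ x → ((PQ Q x).card : ℝ) * (η * Real.log x) ≤
      ∑ p ∈ PQ Q x, Real.log p + x ^ η * (η * Real.log x) := by
    intro η hη x hx
    have hlog : 0 ≤ Real.log x := Real.log_nonneg hx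
    have a1 : ∑ p ∈ PQ Q x, (η * Real.log x) ≤
        ∑ p ∈ PQ Q x, (Real.log p + if (p:ℝ) ≤ x ^ η then η * Real.log x else 0) := by
      apply Finset.sum_le_sum
      intro p hp
      obtain ⟨h1, h2⟩ := hmem x hx p hp
      split_ifs with hp2
      · linarith [Real.log_nonneg h1]
      · push Not at hp2
        have := Real.log_le_log (by positivity) hp2.le
        rw [Real.log_rpow (by linarith)] at this
        linarith
    rw [Finset.sum_const, nsmul_eq_mul, Finset.sum_add_distrib, ← Finset.sum_filter,
      Finset.sum_const, nsmul_eq_mul] at a1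
    refine a1.trans ?_
    gcongr
    have hc : ((PQ Q x).filter (fun p : ℕ => (p:ℝ) ≤ x ^ η)).card ≤ ⌊x ^ η⌋₊ := by
      have : (PQ Q x).filter (fun p : ℕ => (p:ℝ) ≤ x ^ η) ⊆ Finset.Icc 1 ⌊x ^ η⌋₊ := by
        intro p hp
        obtain ⟨hp1, hp2⟩ := Finset.mem_filter.1 hp
        have := Finset.mem_Icc.1 (Finset.mem_filter.1 hp1).1
        exact Finset.mem_Icc.2 ⟨this.1, Nat.le_floor hp2⟩
      simpa using Finset.card_le_card this
    calc _ ≤ ((⌊x ^ η⌋₊ : ℕ) : ℝ) := by exact_mod_cast hc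
      _ ≤ x ^ η := Nat.floor_le (by positivity)
  rw [tendsto_order] 
  constructor
  · intro a ha
    filter_upwards [h.eventually (lt_mem_nhds ha), eventually_ge_atTop 1] with x hx hx1
    refine hx.trans_le ?_
    gcongr
    exact lo x hx1
  · intro a ha
    have hη : Tendsto (fun η : ℝ => c / η) (𝓝[<] 1) (𝓝 c) := by
      have : ContinuousAt (fun η : ℝ => c / η) 1 := by fun_prop (disch := norm_num)
      have := this.tendsto
      rw [div_one] at this
      exact this.mono_left nhdsWithin_le_nhds
    obtain ⟨η, h1, h2⟩ := ((hη.eventually (gt_mem_nhds ha)).and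
      (Ioo_mem_nhdsLT (show (0:ℝ) < 1 by norm_num))).exists
    have hη0 : 0 < η := h2.1
    have hl : Tendsto (fun x : ℝ => Real.log x / x ^ (1 - η)) atTop (𝓝 0) :=
      (isLittleO_log_rpow_atTop (sub_pos.2 h2.2)).tendsto_div_nhds_zero
    have hs := (h.div_const η).add hl
    rw [add_zero] at hs
    filter_upwards [hs.eventually (gt_mem_nhds h1), eventually_ge_atTop 1] with x hx hx1
    refine lt_of_le_of_lt ?_ hx
    have hx0 : 0 < x := by linarith
    have u := up η hη0 x hx1
    have e : Real.log x / x ^ (1 - η) = x ^ η * Real.log x / x := by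
      rw [Real.rpow_sub hx0, Real.rpow_one]
      have : 0 < x ^ η := by positivity
      field_simp
    rw [e, div_right_comm, ← add_div]
    gcongr
    rw [div_add' _ _ _ hη0.ne', le_div_iff₀ hη0]
    linarith

theorem pi_ap (N : ℕ) [NeZero N] (b : ZMod N) (hb : IsUnit b) :
    Tendsto (fun x : ℝ => ((PQ (fun p => (p : ZMod N) = b) x).card : ℝ) * Real.log x / x) atTop
      (𝓝 ((N.totient : ℝ)⁻¹)) := pi_of_theta _ _ (theta_ap N b hb)

end PNTAux
namespace PNTAux
open Topology
open scoped Classical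

lemma jac_mod {N q b : ℕ} (hq : 4 * q ∣ N) (h2 : 2 ∣ N) (hb : Odd b) :
    jacobiSym (q : ℤ) (b % N) = jacobiSym (q : ℤ) b := by
  have hb' : Odd (b % N) := hb.mod_even (even_iff_two_dvd.2 h2)
  rw [jacobiSym.mod_right' q hb', jacobiSym.mod_right' q hb, Nat.mod_mod_of_dvd _ hq]

lemma exists_sign {q : ℕ} (hq : q.Prime) (hq2 : q ≠ 2) {e : ℤ} (he : e = 1 ∨ e = -1) :
    ∃ r : ℕ, jacobiSym (r : ℤ) q = e := by
  haveI := Fact.mk hq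
  rcases he with rfl | rfl
  · exact ⟨1, by simp⟩
  · obtain ⟨a, ha⟩ := quadraticChar_exists_neg_one (F := ZMod q) (by rwa [ZMod.ringChar_zmod_n])
    refine ⟨a.val, ?_⟩
    rw [← jacobiSym.legendreSym.to_jacobiSym, legendreSym]
    simpa using ha

lemma exists_b (m : ℕ) (τ : ℕ → ℤ) (hτ : ∀ q, τ q = 1 ∨ τ q = -1) :
    ∃ b : ℕ, Odd b ∧ ∀ q, q.Prime → q ≤ m → jacobiSym (q : ℤ) b = τ q := by
  have hr : ∀ q : ℕ, ∃ r : ℕ, q.Prime → q ≠ 2 → jacobiSym (r : ℤ) q = τ q := by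
    intro q
    by_cases h : q.Prime ∧ q ≠ 2
    · obtain ⟨r, hr⟩ := exists_sign h.1 h.2 (hτ q)
      exact ⟨r, fun _ _ => hr⟩
    · exact ⟨0, fun h1 h2 => (h ⟨h1, h2⟩).elim⟩
  choose r hr using hr
  set T : Finset ℕ := insert 2 ((Finset.range (m + 1)).filter Nat.Prime) with hT
  have hTp : ∀ q ∈ T, q.Prime := by
    intro q hq
    rcases Finset.mem_insert.1 hq with rfl | hq
    · exact Nat.prime_two
    · exact (Finset.mem_filter.1 hq).2
  obtain ⟨b, hb⟩ := Nat.chineseRemainderOfFinset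
    (fun q => if q = 2 then (if τ 2 = 1 then 1 else 5) else r q) (fun q => if q = 2 then 8 else q)
    T (by
      intro q hq
      have := (hTp q hq).ne_zero
      split_ifs
      · norm_num
      · exact this) (by
      intro p hp q hq hpq
      have hp' := hTp p hp
      have hq' := hTp q hq
      have hc : Nat.Coprime p q := (Nat.coprime_primes hp' hq').2 hpq
      simp only [Function.onFun]
      split_ifs with h1 h2 h2
      · exact (hpq (h1.trans h2.symm)).elim
      · subst h1
        exact Nat.Coprime.pow_left 3 hc
      · subst h2
        exact Nat.Coprime.pow_right 3 hc
      · exact hc)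
  have h8 := hb 2 (by simp [hT])
  simp only [if_true] at h8
  have hb4 : b % 4 = 1 := by
    split_ifs at h8 <;> (unfold Nat.ModEq at h8; omega)
  have hodd : Odd b := Nat.odd_iff.2 (by omega)
  refine ⟨b, hodd, ?_⟩
  intro q hq hqm
  by_cases h2 : q = 2
  · subst h2
    have : ((2:ℕ):ℤ) = 2 := rfl
    rw [this, jacobiSym.at_two hodd, ZMod.χ₈_nat_mod_eight]
    split_ifs at h8 with h
    · have : b % 8 = 1 := h8
      rw [this, h]; decide
    · have : b % 8 = 5 := h8
      rw [this, (hτ 2).resolve_left h]; decide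
  · have hqo : Odd q := hq.odd_of_ne_two h2
    have hbq := hb q (by simp [hT, hq]; omega)
    simp only [h2, if_false] at hbq
    rw [jacobiSym.quadratic_reciprocity_one_mod_four' hqo hb4, ← hr q hq h2,
      jacobiSym.mod_left, jacobiSym.mod_left (r q : ℤ)]
    congr 1
    exact_mod_cast hbq

lemma jac_eq_of_primes {m p p' : ℕ} 
    (h : ∀ q : ℕ, q.Prime → q ≤ m → jacobiSym (q : ℤ) p = jacobiSym (q : ℤ) p') :
    ∀ n : ℕ, 1 ≤ n → n ≤ m → jacobiSym (n : ℤ) p = jacobiSym (n : ℤ) p' := by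
  intro n
  induction n using Nat.recOnMul with
  | zero => intro h; omega
  | one => intros; simp
  | prime q hq => intro _ h2; exact h q hq h2
  | mul a b iha ihb =>
    intro h1 h2
    have ha : 1 ≤ a := Nat.pos_of_ne_zero (by rintro rfl; simp at h1)
    have hb : 1 ≤ b := Nat.pos_of_ne_zero (by rintro rfl; simp at h1)
    push_cast
    rw [jacobiSym.mul_left, jacobiSym.mul_left, iha ha (by nlinarith), ihb hb (by nlinarith)]

lemma S_pred {p : ℕ} (hp : p.Prime) (hp2 : p ≠ 2) : S (p - 1) p = 0 := by
  haveI := Fact.mk hp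
  have h1 : ∑ n ∈ Finset.range p, jacobiSym (n : ℤ) p = ∑ a : ZMod p, quadraticChar (ZMod p) a := by
    refine Finset.sum_bij' (fun n _ => (n : ZMod p)) (fun a _ => a.val) ?_ ?_ ?_ ?_ ?_
    · simp
    · intro a _; simpa using ZMod.val_lt a
    · intro n hn; simpa using ZMod.val_cast_of_lt (Finset.mem_range.1 hn)
    · intro a _; simp
    · intro n _
      rw [← jacobiSym.legendreSym.to_jacobiSym, legendreSym]
      simp
  rw [quadraticChar_sum_zero (by rwa [ZMod.ringChar_zmod_n]), Finset.range_eq_Ico,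
    Finset.sum_eq_sum_Ico_succ_bot hp.pos] at h1
  have h0 : jacobiSym ((0:ℕ):ℤ) p = 0 := by
    rw [← jacobiSym.legendreSym.to_jacobiSym]; simp
  rw [h0, zero_add] at h1
  unfold S
  convert h1 using 2
  ext n
  have := hp.pos
  simp only [Finset.mem_Icc, Finset.mem_Ico]
  omega

lemma fpt_transfer {ε : ℝ} (hε : 0 < ε) {m p p' : ℕ} (hp' : p'.Prime) (hp2 : p' ≠ 2)
    (h : ∀ q : ℕ, q.Prime → q ≤ m → jacobiSym (q : ℤ) p = jacobiSym (q : ℤ) p')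
    (hf : m < fpt ε p) : m < fpt ε p' := by
  by_contra! hle
  have hne : {ℓ : ℕ | 1 ≤ ℓ ∧ ((S ℓ p' : ℝ)) < ε * ℓ}.Nonempty := by
    refine ⟨p' - 1, ?_, ?_⟩
    · have := hp'.two_le; omega
    · rw [S_pred hp' hp2]
      have : 0 < p' - 1 := by have := hp'.two_le; omega
      simp only [Int.cast_zero]
      positivity
  have hmem := Nat.sInf_mem hne
  change 1 ≤ fpt ε p' ∧ ((S (fpt ε p') p' : ℝ)) < ε * (fpt ε p' : ℕ) at hmem
  have hS : S (fpt ε p') p = S (fpt ε p') p' := by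
    unfold S
    apply Finset.sum_congr rfl
    intro n hn
    obtain ⟨h1, h2⟩ := Finset.mem_Icc.1 hn
    exact jac_eq_of_primes h n h1 (h2.trans hle)
  rw [← hS] at hmem
  have : fpt ε p ≤ fpt ε p' := Nat.sInf_le hmem
  omega

lemma sandwich (W g : ℝ → ℕ) (K : ℕ) (c : ℝ) (h1 : ∀ x, W x ≤ g x) (h2 : ∀ x, g x ≤ W x + K)
    (h : Tendsto (fun x : ℝ => (W x : ℝ) * Real.log x / x) atTop (𝓝 c)) :
    Tendsto (fun x : ℝ => (g x : ℝ) * Real.log x / x) atTop (𝓝 c) := by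
  have hl : Tendsto (fun x : ℝ => (K : ℝ) * (Real.log x / x)) atTop (𝓝 ((K:ℝ) * 0)) :=
    (Real.isLittleO_log_id_atTop.tendsto_div_nhds_zero).const_mul _
  have hs := h.add hl
  rw [mul_zero, add_zero] at hs
  refine tendsto_of_tendsto_of_tendsto_of_le_of_le' h hs ?_ ?_
  · filter_upwards [eventually_ge_atTop 1] with x hx
    have := Real.log_nonneg hx
    have := h1 x
    gcongr
  · filter_upwards [eventually_ge_atTop 1] with x hx
    have hlog := Real.log_nonneg hx
    have : (g x : ℝ) ≤ W x + K := by exact_mod_cast h2 x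
    rw [← mul_div_assoc, ← add_div, ← add_mul]
    gcongr

lemma mem_PQ {Q : ℕ → Prop} {x : ℝ} {p : ℕ} : p ∈ PQ Q x ↔ p ≤ ⌊x⌋₊ ∧ p.Prime ∧ Q p := by
  simp only [PQ, Finset.mem_filter, Finset.mem_Icc]
  constructor
  · rintro ⟨⟨_, h⟩, h1, h2⟩; exact ⟨h, h1, h2⟩
  · rintro ⟨h, h1, h2⟩; exact ⟨⟨h1.one_le, h⟩, h1, h2⟩

/-- union of residue classes -/
lemma pi_union (N : ℕ) [NeZero N] (B : Finset (ZMod N)ˣ) :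
    Tendsto (fun x : ℝ => ((PQ (fun p => ∃ u ∈ B, (p : ZMod N) = u) x).card : ℝ) * Real.log x / x)
      atTop (𝓝 ((B.card : ℝ) * (N.totient : ℝ)⁻¹)) := by
  have h := tendsto_finsetSum B (fun u _ => pi_ap N (u : ZMod N) u.isUnit)
  rw [Finset.sum_const, nsmul_eq_mul] at h
  refine h.congr fun x => ?_
  rw [← Finset.sum_div, ← Finset.sum_mul]
  congr 2
  have : PQ (fun p => ∃ u ∈ B, (p : ZMod N) = u) x =
      B.biUnion (fun u => PQ (fun p => (p : ZMod N) = u) x) := by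
    ext p
    simp only [PQ, Finset.mem_filter, Finset.mem_biUnion]
    constructor
    · rintro ⟨h1, h2, u, hu, h3⟩
      exact ⟨u, hu, h1, h2, h3⟩
    · rintro ⟨u, hu, h1, h2, h3⟩
      exact ⟨h1, h2, u, hu, h3⟩
  rw [this, Finset.card_biUnion, Nat.cast_sum]
  intro u _ v _ huv
  rw [Function.onFun, Finset.disjoint_left]
  intro p hp hq
  apply huv
  apply Units.ext
  exact (mem_PQ.1 hp).2.2.symm.trans (mem_PQ.1 hq).2.2

abbrev Idx (m : ℕ) := {q : ℕ // q.Prime ∧ q ≤ m}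

instance (m : ℕ) : Fintype (Idx m) :=
  Fintype.subtype ((Finset.range (m + 1)).filter Nat.Prime) (by
    intro q; simp; constructor <;> rintro ⟨h1, h2⟩ <;> exact ⟨by first | exact h2 | omega, by first | exact h1 | omega⟩)

lemma card_Idx (m : ℕ) : Fintype.card (Idx m) = ((Finset.range (m + 1)).filter Nat.Prime).card :=
  Fintype.card_of_subtype _ (by
    intro q
    rw [Finset.mem_filter, Finset.mem_range, Nat.lt_succ_iff, and_comm])

def NN (m : ℕ) : ℕ := 4 * m.factorial

instance (m : ℕ) : NeZero (NN m) := ⟨by unfold NN; positivity⟩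

lemma NN_dvd {m q : ℕ} (h1 : 1 ≤ q) (h : q ≤ m) : 4 * q ∣ NN m :=
  Nat.mul_dvd_mul_left 4 (Nat.dvd_factorial h1 h)

lemma two_dvd_NN (m : ℕ) : 2 ∣ NN m := Dvd.dvd.mul_right (by norm_num) _

lemma odd_of_cop {m b : ℕ} (h : Nat.Coprime b (NN m)) : Odd b := by
  have := Nat.Coprime.coprime_dvd_right (two_dvd_NN m) h
  exact Nat.coprime_two_right.1 this

def vhom (m : ℕ) : (ZMod (NN m))ˣ →* (Idx m → ℤ) where
  toFun u := fun i => jacobiSym ((i : ℕ) : ℤ) (u : ZMod (NN m)).val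
  map_one' := by
    ext i
    have h : Nat.Coprime 1 (NN m) := Nat.coprime_one_left _
    have e : ((1 : (ZMod (NN m))ˣ) : ZMod (NN m)).val = 1 % NN m := by
      rw [Units.val_one, ← ZMod.val_natCast, Nat.cast_one]
    rw [e, jac_mod (NN_dvd i.2.1.one_le i.2.2) (two_dvd_NN m) odd_one]
    simp
  map_mul' u v := by
    ext i
    have hu := odd_of_cop (ZMod.val_coe_unit_coprime u)
    have hv := odd_of_cop (ZMod.val_coe_unit_coprime v)
    rw [Units.val_mul, ZMod.val_mul, jac_mod (NN_dvd i.2.1.one_le i.2.2) (two_dvd_NN m) (hu.mul hv)]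
    haveI : NeZero (u : ZMod (NN m)).val := ⟨fun h => by rw [h] at hu; simp at hu⟩
    haveI : NeZero (v : ZMod (NN m)).val := ⟨fun h => by rw [h] at hv; simp at hv⟩
    rw [jacobiSym.mul_right]
    rfl

lemma vhom_of_nat {m p : ℕ} (u : (ZMod (NN m))ˣ) (hu : (p : ZMod (NN m)) = u) (hp : Odd p)
    (i : Idx m) : vhom m u i = jacobiSym ((i : ℕ) : ℤ) p := by
  change jacobiSym ((i : ℕ) : ℤ) (u : ZMod (NN m)).val = _
  rw [← hu, ZMod.val_natCast, jac_mod (NN_dvd i.2.1.one_le i.2.2) (two_dvd_NN m) hp]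

def EE (m : ℕ) : Finset (Idx m → ℤ) := Fintype.piFinset (fun _ => ({1, -1} : Finset ℤ))

lemma card_EE (m : ℕ) : (EE m).card = 2 ^ ((Finset.range (m + 1)).filter Nat.Prime).card := by
  rw [EE, Fintype.card_piFinset, Finset.prod_const, Finset.card_univ, card_Idx]
  rfl

lemma vhom_mem (m : ℕ) (u : (ZMod (NN m))ˣ) : vhom m u ∈ EE m := by
  rw [EE, Fintype.mem_piFinset]
  intro i
  have : Nat.Coprime (i : ℕ) (u : ZMod (NN m)).val := by
    apply Nat.Coprime.symm
    exact Nat.Coprime.coprime_dvd_right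
      ((Dvd.intro_left 4 rfl).trans (NN_dvd i.2.1.one_le i.2.2)) (ZMod.val_coe_unit_coprime u)
  have := jacobiSym.eq_one_or_neg_one (a := ((i : ℕ) : ℤ)) (b := (u : ZMod (NN m)).val)
    (by rw [Int.gcd_natCast_natCast]; exact this)
  rw [Finset.mem_insert, Finset.mem_singleton]
  exact this

lemma coprime_of_jac {m b : ℕ} (hb : Odd b)
    (h : ∀ q : ℕ, q.Prime → q ≤ m → ¬ q ∣ b) : Nat.Coprime b (NN m) := by
  unfold NN
  apply Nat.Coprime.mul_right
  · exact Nat.Coprime.pow_right 2 (Nat.coprime_two_right.2 hb)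
  · apply Nat.coprime_of_dvd
    intro q hq h1 h2
    exact h q hq ((Nat.Prime.dvd_factorial hq).1 h2) h1

lemma vhom_surj (m : ℕ) (σ : Idx m → ℤ) (hσ : σ ∈ EE m) : σ ∈ Set.range (vhom m) := by
  rw [EE, Fintype.mem_piFinset] at hσ
  obtain ⟨b, hb, hb2⟩ := exists_b m (fun q => if h : q.Prime ∧ q ≤ m then σ ⟨q, h⟩ else 1) (by
    intro q
    split_ifs with h
    · simpa using hσ ⟨q, h⟩
    · simp)
  have hcop : Nat.Coprime b (NN m) := by
    apply coprime_of_jac hb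
    intro q hq hqm hd
    have h1 := hb2 q hq hqm
    simp only [hq, hqm, and_self, dif_pos] at h1
    have h2 := hσ ⟨q, hq, hqm⟩
    rw [← h1] at h2
    haveI : NeZero b := ⟨fun h => by rw [h] at hb; simp at hb⟩
    have h3 : jacobiSym (q : ℤ) b = 0 := by
      rw [jacobiSym.eq_zero_iff_not_coprime]
      rw [Int.gcd_natCast_natCast, Nat.gcd_eq_left hd]
      exact hq.one_lt.ne'
    rw [h3] at h2
    simp at h2
  refine ⟨ZMod.unitOfCoprime b hcop, ?_⟩
  ext i
  rw [vhom_of_nat _ (ZMod.coe_unitOfCoprime b hcop).symm hb, hb2 i i.2.1 i.2.2]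
  simp [i.2.1, i.2.2]

lemma fiber_card (m : ℕ) (σ : Idx m → ℤ) (hσ : σ ∈ EE m) :
    2 ^ ((Finset.range (m + 1)).filter Nat.Prime).card *
      (Finset.univ.filter (fun u => vhom m u = σ)).card = (NN m).totient := by
  have h := Finset.card_eq_sum_card_fiberwise (s := Finset.univ) (f := vhom m) (t := EE m)
    (fun u _ => vhom_mem m u)
  rw [← ZMod.card_units_eq_totient, ← Finset.card_univ, h, ← card_EE, ← smul_eq_mul, ← Finset.sum_const]
  apply Finset.sum_congr rfl
  intro τ hτ
  exact MonoidHom.card_fiber_eq_of_mem_range (vhom m) (vhom_surj m σ hσ) (vhom_surj m τ hτ)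

lemma fiber_card_set (m : ℕ) (A : Finset (Idx m → ℤ)) (hA : A ⊆ EE m) :
    ((Finset.univ.filter (fun u => vhom m u ∈ A)).card : ℝ) * ((NN m).totient : ℝ)⁻¹ =
      (A.card : ℝ) / 2 ^ ((Finset.range (m + 1)).filter Nat.Prime).card := by
  set k := ((Finset.range (m + 1)).filter Nat.Prime).card with hk
  have h1 : 2 ^ k * (Finset.univ.filter (fun u => vhom m u ∈ A)).card = A.card * (NN m).totient := by
    have h := Finset.card_eq_sum_card_fiberwise
      (s := Finset.univ.filter (fun u => vhom m u ∈ A)) (f := vhom m) (t := A)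
      (fun u hu => (Finset.mem_filter.1 hu).2)
    rw [h, Finset.mul_sum, ← smul_eq_mul (a := A.card),
      ← Finset.sum_const]
    apply Finset.sum_congr rfl
    intro σ hσ
    rw [← fiber_card m σ (hA hσ)]
    congr 2
    ext u
    simp only [Finset.mem_filter, Finset.mem_univ, true_and, and_iff_right_iff_imp]
    rintro rfl; exact hσ
  have h2 : (0:ℝ) < (NN m).totient := by
    exact_mod_cast Nat.totient_pos.2 (Nat.pos_of_ne_zero (NeZero.ne _))
  rw [← div_eq_mul_inv, div_eq_div_iff h2.ne' (by positivity), mul_comm]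
  exact_mod_cast h1

lemma big_of_unit {m p : ℕ} (hp : p.Prime) (u : (ZMod (NN m))ˣ) (hu : (p : ZMod (NN m)) = u) :
    m < p ∧ p ≠ 2 := by
  have hc : Nat.Coprime p (NN m) := by
    rw [← ZMod.isUnit_iff_coprime, hu]; exact u.isUnit
  constructor
  · by_contra! hle
    have : p ∣ NN m := (Dvd.intro_left 4 rfl).trans (NN_dvd hp.one_le hle)
    exact hp.one_lt.ne' (Nat.Coprime.eq_one_of_dvd hc this)
  · rintro rfl
    exact absurd (odd_of_cop hc) (by decide)

lemma unit_of_big {m p : ℕ} (hp : p.Prime) (hp2 : p ≠ 2) (hm : m < p) : Nat.Coprime p (NN m) := by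
  apply coprime_of_jac (hp.odd_of_ne_two hp2)
  intro q hq hqm hd
  have := (Nat.prime_dvd_prime_iff_eq hq hp).1 hd
  omega

lemma mem_odd {x : ℝ} {p : ℕ} : p ∈ oddPrimesUpTo x ↔ p ≤ ⌊x⌋₊ ∧ p.Prime ∧ p ≠ 2 := by
  simp [oddPrimesUpTo, Nat.lt_succ_iff]

lemma count (m : ℕ) (B : Finset (ZMod (NN m))ˣ) (R : ℕ → Prop)
    (hR : ∀ p (u : (ZMod (NN m))ˣ), p.Prime → p ≠ 2 → m < p → (p : ZMod (NN m)) = u → (R p ↔ u ∈ B)) :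
    Tendsto (fun x : ℝ => (((oddPrimesUpTo x).filter R).card : ℝ) * Real.log x / x)
      atTop (𝓝 ((B.card : ℝ) * ((NN m).totient : ℝ)⁻¹)) := by
  refine sandwich _ (fun x => ((oddPrimesUpTo x).filter R).card) (m + 1) _ ?_ ?_ (pi_union (NN m) B)
  · intro x
    apply Finset.card_le_card
    intro p hp
    obtain ⟨h1, h2, u, hu, hpu⟩ := mem_PQ.1 hp
    obtain ⟨h3, h4⟩ := big_of_unit h2 u hpu
    exact Finset.mem_filter.2 ⟨mem_odd.2 ⟨h1, h2, h4⟩, (hR p u h2 h4 h3 hpu).2 hu⟩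
  · intro x
    have : (oddPrimesUpTo x).filter R ⊆
        PQ (fun p => ∃ u ∈ B, (p : ZMod (NN m)) = u) x ∪ Finset.range (m + 1) := by
      intro p hp
      obtain ⟨h1, h2⟩ := Finset.mem_filter.1 hp
      obtain ⟨h3, h4, h5⟩ := mem_odd.1 h1
      rw [Finset.mem_union]
      by_cases hm : m < p
      · left
        have hu := (ZMod.coe_unitOfCoprime p (unit_of_big h4 h5 hm)).symm
        exact mem_PQ.2 ⟨h3, h4, _, (hR p _ h4 h5 hm hu).1 h2, hu⟩
      · right
        simp; omega
    refine (Finset.card_le_card this).trans ((Finset.card_union_le _ _).trans ?_)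
    simp

end PNTAux

/-- For fixed `ε ∈ (0,1]` and `m ≥ 1`, the limit `lim_{x→∞} a_m(x)` exists and equals
`|A_m| / 2^(π(m))`, where `A_m` is the set of sign vectors `σ = ((q/p))_{q ≤ m prime}`
realized by some odd prime `p > m` with `f_ε(p) > m`. -/
theorem stmt10 (ε : ℝ) (hε : 0 < ε) (hε1 : ε ≤ 1) (m : ℕ) (hm : 1 ≤ m) :
    Filter.Tendsto (fun x : ℝ => aCoef ε m x) Filter.atTop
      (nhds ((Set.ncard {σ : {q : ℕ // q.Prime ∧ q ≤ m} → ℤ |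
          ∃ p : ℕ, p.Prime ∧ p ≠ 2 ∧ m < p ∧
            (∀ i : {q : ℕ // q.Prime ∧ q ≤ m}, σ i = jacobiSym ((i : ℕ) : ℤ) p) ∧
            m < fpt ε p} : ℝ) /
        2 ^ (((Finset.range (m + 1)).filter Nat.Prime).card))) := by
  classical
  set As := {σ : {q : ℕ // q.Prime ∧ q ≤ m} → ℤ |
          ∃ p : ℕ, p.Prime ∧ p ≠ 2 ∧ m < p ∧
            (∀ i : {q : ℕ // q.Prime ∧ q ≤ m}, σ i = jacobiSym ((i : ℕ) : ℤ) p) ∧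
            m < fpt ε p} with hAs
  have hsub : As ⊆ (PNTAux.EE m : Set (PNTAux.Idx m → ℤ)) := by
    rintro σ ⟨p, hp, hp2, hmp, hσ, -⟩
    have hu := (ZMod.coe_unitOfCoprime p (PNTAux.unit_of_big hp hp2 hmp)).symm
    have : σ = PNTAux.vhom m (ZMod.unitOfCoprime p (PNTAux.unit_of_big hp hp2 hmp)) := by
      ext i
      rw [hσ i, PNTAux.vhom_of_nat _ hu (hp.odd_of_ne_two hp2)]
    rw [this]
    exact PNTAux.vhom_mem m _
  have hfin : As.Finite := (Finset.finite_toSet _).subset hsub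
  have hsub' : hfin.toFinset ⊆ PNTAux.EE m := by
    intro σ hσ
    exact hsub (hfin.mem_toFinset.1 hσ)
  rw [Set.ncard_eq_toFinset_card As hfin, ← PNTAux.fiber_card_set m _ hsub']
  have h1 := PNTAux.count m (Finset.univ.filter (fun u => PNTAux.vhom m u ∈ hfin.toFinset))
    (fun p => m < fpt ε p) (by
      intro p u hp hp2 hmp hu
      have hv := PNTAux.vhom_of_nat u hu (hp.odd_of_ne_two hp2)
      rw [Finset.mem_filter, hfin.mem_toFinset]
      constructor
      · intro h
        exact ⟨Finset.mem_univ _, p, hp, hp2, hmp, hv, h⟩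
      · rintro ⟨-, p', hp', hp2', hmp', hv', h⟩
        refine PNTAux.fpt_transfer hε hp hp2 ?_ h
        intro q hq hqm
        rw [← hv' ⟨q, hq, hqm⟩, hv ⟨q, hq, hqm⟩])
  have h2 := PNTAux.count m Finset.univ (fun _ => True) (by intros; simp)
  have htot : (0:ℝ) < (PNTAux.NN m).totient := by
    exact_mod_cast Nat.totient_pos.2 (Nat.pos_of_ne_zero (NeZero.ne _))
  rw [Finset.card_univ, ZMod.card_units_eq_totient, mul_inv_cancel₀ htot.ne'] at h2
  have h3 := h1.div h2 one_ne_zero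
  rw [div_one] at h3
  refine h3.congr' ?_
  filter_upwards [eventually_gt_atTop 1] with x hx
  have hlog : Real.log x / x ≠ 0 := (div_pos (Real.log_pos hx) (by linarith)).ne'
  simp only [Pi.div_apply, aCoef, piOdd]
  have e : ∀ a : ℝ, a * Real.log x / x = a * (Real.log x / x) := fun a => mul_div_assoc ..
  rw [e, e, mul_div_mul_right _ _ hlog, Finset.filter_true]
  congr!

end
end
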